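/- arXiv:0912.1068 — 3 statements merged into one kernel-verified Lean document; each statement's English description precedes it below -/
import Mathlib

section
/- Let d ≥ 2 be an integer, k ∈ ℚ with k ≥ 2, and l ∈ ℚ. Assume that every rational polytope Q ⊂ ℝ^d of dimension d all of whose edges have lattice length at least l satisfies BCN(d,k). Then every rational polytope P ⊂ ℝ^d of dimension d all of whose edges have lattice length greater than max(k·d·(d+1), l) is k-convex-normal. -/
open Set Metric Pointwise

noncomputable section

/-- Points of the Euclidean space `ℝ^d`. -/
abbrev Pt (d : ℕ) : Type := EuclideanSpace ℝ (Fin d)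

/-- `x` is a point of the standard lattice `ℤ^d ⊂ ℝ^d`. -/
def IsLatticePt {d : ℕ} (x : Pt d) : Prop := ∀ i, ∃ n : ℤ, x i = (n : ℝ)

/-- `x` has rational coordinates. -/
def IsRatPt {d : ℕ} (x : Pt d) : Prop := ∀ i, ∃ q : ℚ, x i = (q : ℝ)

/-- `P` is a polytope with rational vertices. -/
def IsRationalPolytope {d : ℕ} (P : Set (Pt d)) : Prop :=
  ∃ V : Finset (Pt d), (∀ v ∈ V, IsRatPt v) ∧ P = convexHull ℝ (V : Set (Pt d))

/-- `P` is a polytope with integral vertices. -/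
def IsLatticePolytope {d : ℕ} (P : Set (Pt d)) : Prop :=
  ∃ V : Finset (Pt d), (∀ v ∈ V, IsLatticePt v) ∧ P = convexHull ℝ (V : Set (Pt d))

/-- The (affine) dimension of a set. -/
def polyDim {d : ℕ} (P : Set (Pt d)) : ℕ := Module.finrank ℝ (vectorSpan ℝ P)

/-- An integer vector is primitive if its components are coprime. -/
def IsPrimitive {d : ℕ} (u : Fin d → ℤ) : Prop := Finset.univ.gcd u = 1

/-- The segment `[v, w]` has lattice length at least `lb`: whenever `w - v = t • u` with
`u` a primitive integer vector and `t > 0`, one has `t ≥ lb`. -/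
def LatLenGE {d : ℕ} (v w : Pt d) (lb : ℝ) : Prop :=
  ∀ (u : Fin d → ℤ) (t : ℝ), 0 < t → IsPrimitive u →
    (∀ i, w i - v i = t * (u i : ℝ)) → lb ≤ t

/-- The segment `[v, w]` has lattice length greater than `lb`. -/
def LatLenGT {d : ℕ} (v w : Pt d) (lb : ℝ) : Prop :=
  ∀ (u : Fin d → ℤ) (t : ℝ), 0 < t → IsPrimitive u →
    (∀ i, w i - v i = t * (u i : ℝ)) → lb < t

/-- `[v, w]` is an edge (a one-dimensional face) of `P`. -/
def IsEdge {d : ℕ} (P : Set (Pt d)) (v w : Pt d) : Prop :=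
  v ≠ w ∧ IsExtreme ℝ P (segment ℝ v w)

/-- Every edge of `P` has lattice length at least `lb`. -/
def EdgeLengthsGE {d : ℕ} (P : Set (Pt d)) (lb : ℝ) : Prop :=
  ∀ v w, IsEdge P v w → LatLenGE v w lb

/-- Every edge of `P` has lattice length greater than `lb`. -/
def EdgeLengthsGT {d : ℕ} (P : Set (Pt d)) (lb : ℝ) : Prop :=
  ∀ v w, IsEdge P v w → LatLenGT v w lb

/-- The union `⋃ (x + P)` over all vertices `v` of `P` and all
`x ∈ (c-1)P ∩ ((c-1)v + ℤ^d)`. -/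
def cnUnion {d : ℕ} (P : Set (Pt d)) (c : ℝ) : Set (Pt d) :=
  {y | ∃ v ∈ Set.extremePoints ℝ P, ∃ x ∈ (c - 1) • P,
    IsLatticePt (x - (c - 1) • v) ∧ ∃ p ∈ P, y = x + p}

/-- `P` is `k`-convex-normal: `CN(d,k)`. -/
def ConvexNormal {d : ℕ} (k : ℚ) (P : Set (Pt d)) : Prop :=
  ∀ c : ℚ, 2 ≤ c → c ≤ k → (c : ℝ) • P = cnUnion P (c : ℝ)

/-- `P` is integrally closed. -/
def IntegrallyClosed {d : ℕ} (P : Set (Pt d)) : Prop :=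
  ∀ c : ℕ, 0 < c → ∀ z ∈ (c : ℝ) • P, IsLatticePt z →
    ∃ x : Fin c → Pt d, (∀ i, x i ∈ P ∧ IsLatticePt (x i)) ∧ ∑ i, x i = z

/-- A face of a polytope: a closed convex extreme subset. -/
def IsFaceOf {d : ℕ} (P F : Set (Pt d)) : Prop :=
  IsExtreme ℝ P F ∧ Convex ℝ F ∧ IsClosed F

/-- A facet: a face of codimension one. -/
def IsFacetOf {d : ℕ} (P F : Set (Pt d)) : Prop :=
  IsFaceOf P F ∧ polyDim F + 1 = polyDim P

/-- `width_F(P)`: the maximum over vertices `v` of `P` of `dist(v, aff F)`. -/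
def facetWidth {d : ℕ} (P F : Set (Pt d)) : ℝ :=
  sSup ((fun v => infDist v ((affineSpan ℝ F : AffineSubspace ℝ (Pt d)) : Set (Pt d))) ''
    Set.extremePoints ℝ P)

/-- `U_P(F, ε)`: the `ε`-layer of `P` along (the affine hull of) `F`. -/
def layer {d : ℕ} (P F : Set (Pt d)) (ε : ℝ) : Set (Pt d) :=
  {x ∈ P | infDist x ((affineSpan ℝ F : AffineSubspace ℝ (Pt d)) : Set (Pt d)) ≤ ε}

/-- `P` is `k`-boundary-convex-normal: `BCN(d,k)`. -/
def BCN {d : ℕ} (k : ℚ) (P : Set (Pt d)) : Prop :=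
  ∀ F, IsFacetOf P F → ∀ c : ℚ, 2 ≤ c → c ≤ k →
    layer ((c : ℝ) • P) ((c : ℝ) • F) (facetWidth P F / ((d : ℝ) + 1)) ⊆ cnUnion P (c : ℝ)

/-- The parallelepiped `z + {Σ λᵢ • wᵢ : 0 ≤ λᵢ ≤ 1}`. -/
def Parallelepiped {d m : ℕ} (z : Pt d) (w : Fin m → Pt d) : Set (Pt d) :=
  {x | ∃ lam : Fin m → ℝ, (∀ i, lam i ∈ Icc (0 : ℝ) 1) ∧ x = z + ∑ i, lam i • w i}

/-- `L` is a full-dimensional lattice parallelepiped. -/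
def IsLatticeParallelepiped {d : ℕ} (L : Set (Pt d)) : Prop :=
  ∃ (z : Pt d) (w : Fin d → Pt d), IsLatticePt z ∧ (∀ i, IsLatticePt (w i)) ∧
    LinearIndependent ℝ w ∧ L = Parallelepiped z w

lemma aux_lin {E : Type*} [AddCommGroup E] [Module ℝ E] [FiniteDimensional ℝ E]
    (S : Finset E) (hspan : Submodule.span ℝ (S : Set E) = ⊤) (y : E) (n : ℕ) :
    ∀ φ : Module.Dual ℝ E, (∀ s ∈ S, 0 ≤ φ s) → φ y < 0 →
      Module.finrank ℝ E ≤ n + Module.finrank ℝ (Submodule.span ℝ {s | s ∈ S ∧ φ s = 0}) →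
      ∃ ψ : Module.Dual ℝ E, (∀ s ∈ S, 0 ≤ ψ s) ∧ ψ y < 0 ∧
        LinearMap.ker ψ ≤ Submodule.span ℝ {s | s ∈ S ∧ ψ s = 0} := by
  induction n with
  | zero =>
    intro φ h1 h2 h3
    refine ⟨φ, h1, h2, ?_⟩
    have : Submodule.span ℝ {s | s ∈ S ∧ φ s = 0} = ⊤ :=
      Submodule.eq_top_of_finrank_eq (le_antisymm (Submodule.finrank_le _) (by simpa using h3))
    rw [this]
    exact le_top
  | succ n ih =>
    intro φ h1 h2 h3
    by_cases htop : Submodule.span ℝ {s | s ∈ S ∧ φ s = 0} ⊔ Submodule.span ℝ {y} = ⊤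
    · refine ⟨φ, h1, h2, ?_⟩
      intro x hx
      have hx' : x ∈ Submodule.span ℝ {s | s ∈ S ∧ φ s = 0} ⊔ Submodule.span ℝ {y} := by
        rw [htop]; trivial
      obtain ⟨z, hz, u, hu, rfl⟩ := Submodule.mem_sup.1 hx'
      obtain ⟨a, rfl⟩ := Submodule.mem_span_singleton.1 hu
      have hz0 : φ z = 0 := by
        have : Submodule.span ℝ {s | s ∈ S ∧ φ s = 0} ≤ LinearMap.ker φ :=
          Submodule.span_le.2 (fun s hs => hs.2)
        exact this hz
      have : a * φ y = 0 := by simpa [hz0] using hx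
      have ha : a = 0 := by
        rcases mul_eq_zero.1 this with h | h
        · exact h
        · exact absurd h h2.ne
      simpa [ha] using hz
    · obtain ⟨g, hg0, hg⟩ := Submodule.exists_le_ker_of_lt_top _ (lt_top_iff_ne_top.2 htop)
      have hgy : g y = 0 := hg (Submodule.mem_sup_right (Submodule.mem_span_singleton_self y))
      have hgZ : ∀ s ∈ S, φ s = 0 → g s = 0 := fun s hs h =>
        hg (Submodule.mem_sup_left (Submodule.subset_span ⟨hs, h⟩))
      obtain ⟨g, hgy, hgZ, s0, hs0, hgs0⟩ : ∃ g : Module.Dual ℝ E, g y = 0 ∧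
          (∀ s ∈ S, φ s = 0 → g s = 0) ∧ ∃ s ∈ S, g s < 0 := by
        have : ∃ s ∈ S, g s ≠ 0 := by
          by_contra! hcon
          apply hg0
          have : Submodule.span ℝ (S : Set E) ≤ LinearMap.ker g :=
            Submodule.span_le.2 (fun s hs => hcon s hs)
          rw [hspan] at this
          exact LinearMap.ker_eq_top.1 (top_le_iff.1 this)
        obtain ⟨s, hs, h⟩ := this
        rcases lt_or_gt_of_ne h with h | h
        · exact ⟨g, hgy, hgZ, s, hs, h⟩
        · exact ⟨-g, by simp [hgy], fun s hs h => by simp [hgZ s hs h], s, hs, by simpa using h⟩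
      obtain ⟨v, hv, hmin⟩ := Finset.exists_min_image (S.filter (fun s => g s < 0))
        (fun s => φ s / (- g s)) ⟨s0, by simp [hs0, hgs0]⟩
      simp only [Finset.mem_filter] at hv hmin
      set t := φ v / (- g v) with ht
      have ht0 : 0 ≤ t := div_nonneg (h1 v hv.1) (by linarith [hv.2])
      have hv0 : φ v + t * g v = 0 := by
        rw [ht]; field_simp [hv.2.ne]; ring
      have hval : ∀ x, (φ + t • g) x = φ x + t * g x := fun x => by simp
      apply ih (φ + t • g)
      · intro s hs
        rw [hval]
        by_cases hgs : g s < 0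
        · have := hmin s ⟨hs, hgs⟩
          rw [le_div_iff₀ (by linarith)] at this
          linarith
        · have := mul_nonneg ht0 (not_lt.1 hgs)
          linarith [h1 s hs]
      · rw [hval, hgy]; simpa using h2
      · have hvn : v ∉ Submodule.span ℝ {s | s ∈ S ∧ φ s = 0} := by
          intro hmem
          have : Submodule.span ℝ {s | s ∈ S ∧ φ s = 0} ≤ LinearMap.ker g :=
            Submodule.span_le.2 (fun s hs => hgZ s hs.1 hs.2)
          have := this hmem
          exact hv.2.ne this
        have hfr := Submodule.finrank_sup_span_singleton hvn
        have hle : Submodule.span ℝ {s | s ∈ S ∧ φ s = 0} ⊔ Submodule.span ℝ {v} ≤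
            Submodule.span ℝ {s | s ∈ S ∧ (φ + t • g) s = 0} := by
          refine sup_le (Submodule.span_mono ?_) ((Submodule.span_singleton_le_iff_mem _ _).2
            (Submodule.subset_span ⟨hv.1, by rw [hval]; exact hv0⟩))
          intro s hs
          exact ⟨hs.1, by rw [hval, hs.2, hgZ s hs.1 hs.2]; simp⟩
        have := Submodule.finrank_mono hle
        omega

lemma aux_hull_le {E : Type*} [AddCommGroup E] [Module ℝ E] (T : Set E)
    (h : Module.Dual ℝ E) (M : ℝ) (hM : ∀ s ∈ T, h s ≤ M) : ∀ x ∈ convexHull ℝ T, h x ≤ M := by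
  have : convexHull ℝ T ⊆ {x | h x ≤ M} :=
    convexHull_min hM (convex_halfSpace_le h.isLinear M)
  exact this

lemma aux_face {E : Type*} [AddCommGroup E] [Module ℝ E] (T : Finset E)
    (h : Module.Dual ℝ E) (M : ℝ) (hM : ∀ s ∈ T, h s ≤ M) :
    IsExtreme ℝ (convexHull ℝ (T : Set E)) (convexHull ℝ {s | s ∈ T ∧ h s = M}) := by
  have hle := aux_hull_le (T : Set E) h M hM
  have heq : ∀ x ∈ convexHull ℝ {s | s ∈ T ∧ h s = M}, h x = M := by
    have : convexHull ℝ {s | s ∈ T ∧ h s = M} ⊆ {x | h x = M} :=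
      convexHull_min (fun s hs => hs.2) (convex_hyperplane h.isLinear M)
    exact this
  have hconv : ∀ x ∈ convexHull ℝ (T : Set E), h x = M →
      x ∈ convexHull ℝ {s | s ∈ T ∧ h s = M} := by
    intro x hx hxM
    obtain ⟨w, hw0, hw1, rfl⟩ := Finset.mem_convexHull'.1 hx
    have hz : ∑ y ∈ T, w y * (M - h y) = 0 := by
      have : h (∑ y ∈ T, w y • y) = ∑ y ∈ T, w y * h y := by simp [map_sum]
      rw [this] at hxM
      simp only [mul_sub, Finset.sum_sub_distrib, ← Finset.sum_mul, hw1, hxM]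
      ring
    have hz' := (Finset.sum_eq_zero_iff_of_nonneg
      (fun y hy => mul_nonneg (hw0 y hy) (sub_nonneg.2 (hM y hy)))).1 hz
    have hwz : ∀ y ∈ T, h y ≠ M → w y = 0 := by
      intro y hy hne
      rcases mul_eq_zero.1 (hz' y hy) with h' | h'
      · exact h'
      · exact absurd (by linarith) hne
    classical
    have hset : {s | s ∈ T ∧ h s = M} = ((T.filter (fun s => h s = M) : Finset E) : Set E) := by
      ext s; simp
    rw [hset]
    refine Finset.mem_convexHull'.2 ⟨w, fun y hy => hw0 y (Finset.mem_filter.1 hy).1, ?_, ?_⟩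
    · rw [Finset.sum_filter_of_ne, hw1]
      intro y hy hne
      by_contra hcon
      exact hne (hwz y hy hcon)
    · rw [Finset.sum_filter_of_ne]
      intro y hy hne
      by_contra hcon
      exact hne (by simp [hwz y hy hcon])
  refine ⟨convexHull_mono (fun s hs => hs.1), ?_⟩
  intro x hx y hy z hz hxyz
  apply hconv x hx
  have hzM := heq z hz
  obtain ⟨a, b, ha, hb, hab, rfl⟩ := hxyz
  have h1 := hle x hx
  have h2 := hle y hy
  simp only [map_add, map_smul, smul_eq_mul] at hzM
  have : a * (M - h x) + b * (M - h y) = 0 := by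
    have : M = (a + b) * M := by rw [hab, one_mul]
    linarith
  have h3 : 0 ≤ b * (M - h y) := mul_nonneg hb.le (by linarith)
  have h4 : 0 ≤ a * (M - h x) := mul_nonneg ha.le (by linarith)
  have h5 : a * (M - h x) = 0 := by linarith
  rcases mul_eq_zero.1 h5 with h6 | h6 <;> linarith

/-- a nonconstant functional is nonconstant on some extreme segment. -/
lemma aux_edge {E : Type*} [AddCommGroup E] [Module ℝ E]
    (g : Module.Dual ℝ E) (n : ℕ) :
    ∀ T : Finset E, T.card ≤ n → (∃ v ∈ T, ∃ w ∈ T, g v ≠ g w) →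
    ∃ v ∈ T, ∃ w ∈ T, g v ≠ g w ∧ IsExtreme ℝ (convexHull ℝ (T : Set E)) (segment ℝ v w) := by
  classical
  induction n with
  | zero =>
    rintro T hT ⟨v, hv, -⟩
    simp at hT
    simp [hT] at hv
  | succ n ih =>
    rintro T hT ⟨v0, hv0, w0, hw0, hvw0⟩
    have hne : T.Nonempty := ⟨v0, hv0⟩
    obtain ⟨v, hv, hvmin⟩ := Finset.exists_min_image T g hne
    obtain ⟨w, hw, hwmax⟩ := Finset.exists_max_image T g hne
    have hvw : g v < g w := by
      rcases lt_or_gt_of_ne hvw0 with h | h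
      · linarith [hvmin v0 hv0, hwmax w0 hw0]
      · linarith [hvmin w0 hw0, hwmax v0 hv0]
    by_cases hall : ∀ q : Module.Dual ℝ E, ∃ s : ℝ, ∀ x ∈ T, q x - s * g x = q v - s * g v
    · refine ⟨v, hv, w, hw, hvw.ne, ?_⟩
      have hTseg : ∀ x ∈ T, x ∈ segment ℝ v w := by
        intro x hx
        have hx' : x = v + ((g x - g v) / (g w - g v)) • (w - v) := by
          rw [← sub_eq_zero, ← Module.forall_dual_apply_eq_zero_iff ℝ]
          intro q
          obtain ⟨s, hs⟩ := hall q
          have e1 := hs x hx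
          have e2 := hs w hw
          have hpos : g w - g v ≠ 0 := by linarith
          have e3 : q w - q v = s * (g w - g v) := by linarith
          simp only [map_sub, map_add, map_smul, smul_eq_mul, e3]
          field_simp
          linarith
        rw [segment_eq_image']
        refine ⟨(g x - g v) / (g w - g v), ⟨?_, ?_⟩, hx'.symm⟩
        · exact div_nonneg (by linarith [hvmin x hx]) (by linarith)
        · rw [div_le_one (by linarith)]; linarith [hwmax x hx]
      have : convexHull ℝ (T : Set E) = segment ℝ v w := by
        apply Subset.antisymm
        · exact convexHull_min hTseg (convex_segment v w)
        · rw [← convexHull_pair]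
          apply convexHull_mono
          intro x hx
          rcases hx with rfl | rfl
          · exact hv
          · exact hw
      rw [this]
    · push Not at hall
      obtain ⟨q, hq⟩ := hall
      obtain ⟨a, ha, hamax⟩ := Finset.exists_max_image (T.filter (fun x => g x = g v)) q
        ⟨v, by simp [hv]⟩
      simp only [Finset.mem_filter] at ha hamax
      obtain ⟨b, hb, hbmin⟩ := Finset.exists_min_image (T.filter (fun x => g v < g x))
        (fun x => (q a - q x) / (g x - g v)) ⟨w, by simp [hw, hvw]⟩
      simp only [Finset.mem_filter] at hb hbmin
      set t := (q a - q b) / (g b - g v) with ht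
      have htb : t * (g b - g v) = q a - q b := by
        rw [ht, div_mul_cancel₀]; linarith [hb.2]
      set h : Module.Dual ℝ E := q + t • g with hh
      have hval : ∀ x, h x = q x + t * g x := fun x => by simp [hh]
      have hM : ∀ s ∈ T, h s ≤ h a := by
        intro s hs
        rw [hval, hval, ha.2]
        rcases (hvmin s hs).lt_or_eq with hlt | heq
        · have := hbmin s ⟨hs, hlt⟩
          rw [le_div_iff₀ (by linarith)] at this
          linarith
        · have := hamax s ⟨hs, heq.symm⟩
          rw [← heq]; linarith
      have hba : h b = h a := by rw [hval, hval, ha.2]; linarith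
      set T' := T.filter (fun s => h s = h a) with hT'
      have hT'c : T'.card ≤ n := by
        have : T' ⊂ T := by
          refine Finset.filter_ssubset.2 ?_
          obtain ⟨x, hx, hxne⟩ := hq (-t)
          by_contra! hcon
          apply hxne
          have e1 := hcon x hx
          have e2 := hcon v hv
          rw [hval, hval] at e1 e2
          linarith
        have := Finset.card_lt_card this
        omega
      obtain ⟨v', hv', w', hw', hne', hext⟩ := ih T' hT'c
        ⟨a, by simp [hT', ha.1], b, by simp [hT', hb.1, hba], by rw [ha.2]; exact hb.2.ne⟩
      refine ⟨v', (Finset.mem_filter.1 hv').1, w', (Finset.mem_filter.1 hw').1, hne', ?_⟩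
      have hf := aux_face T h (h a) hM
      have hset : {s | s ∈ T ∧ h s = h a} = (T' : Set E) := by
        ext s; simp [hT']
      rw [hset] at hf
      exact hf.trans hext

lemma aux_prim {d : ℕ} (x : Pt d) (hx : IsRatPt x) (hx0 : x ≠ 0) :
    ∃ (u : Fin d → ℤ) (t : ℝ), 0 < t ∧ IsPrimitive u ∧ ∀ i, x i = t * (u i : ℝ) := by
  choose q hq using hx
  let D : ℕ := ∏ i, (q i).den
  have hD : 0 < D := Finset.prod_pos (fun i _ => (q i).pos)
  have hint : ∀ i, ∃ m : ℤ, (q i) * D = m := by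
    intro i
    obtain ⟨e, he⟩ : (q i).den ∣ D := Finset.dvd_prod_of_mem _ (Finset.mem_univ i)
    refine ⟨(q i).num * e, ?_⟩
    rw [he]
    push_cast
    rw [← mul_assoc, Rat.mul_den_eq_num]
  choose m hm using hint
  have hne : ∃ i, x i ≠ 0 := by
    by_contra! hcon
    apply hx0
    ext i; simpa using hcon i
  obtain ⟨i0, hi0⟩ := hne
  obtain ⟨u, hu, hu1⟩ := Finset.extract_gcd m (s := Finset.univ) ⟨i0, Finset.mem_univ _⟩
  have hxm : ∀ i, x i * (D : ℝ) = (m i : ℝ) := by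
    intro i
    have h1 : ((q i * (D : ℚ) : ℚ) : ℝ) = ((m i : ℚ) : ℝ) := by rw [hm i]
    rw [Rat.cast_mul, Rat.cast_natCast, Rat.cast_intCast] at h1
    rw [hq i]; exact h1
  set G := Finset.univ.gcd m with hG
  have hG0 : 0 ≤ G := by
    have : normalize G = G := Finset.normalize_gcd
    rw [← this, ← Int.abs_eq_normalize]; exact abs_nonneg _
  have hGne : G ≠ 0 := by
    intro h0
    have := hu i0 (Finset.mem_univ _)
    rw [h0, zero_mul] at this
    have h2 := hxm i0
    rw [this] at h2
    have hD' : (D : ℝ) ≠ 0 := by exact_mod_cast hD.ne'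
    simp [hi0, hD'] at h2
  have hGp : 0 < (G : ℝ) := by exact_mod_cast lt_of_le_of_ne hG0 hGne.symm
  have hDp : 0 < (D : ℝ) := by exact_mod_cast hD
  refine ⟨u, G / D, by positivity, hu1, fun i => ?_⟩
  have h1 := hxm i
  rw [hu i (Finset.mem_univ _)] at h1
  push_cast at h1
  field_simp
  linarith

lemma aux_facet {d : ℕ} (hd : 2 ≤ d) (V : Finset (Pt d))
    (hV : vectorSpan ℝ (V : Set (Pt d)) = ⊤) (hne : V.Nonempty) (y : Pt d)
    (hy : y ∉ convexHull ℝ (V : Set (Pt d))) :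
    ∃ (a : Pt d) (β : ℝ) (F : Set (Pt d)), a ≠ 0 ∧ (∀ v ∈ V, 0 ≤ inner ℝ a v + β) ∧
      inner ℝ a y + β < 0 ∧ IsFacetOf (convexHull ℝ (V : Set (Pt d))) F ∧
      (affineSpan ℝ F : Set (Pt d)).Nonempty ∧
      ∀ x, x ∈ affineSpan ℝ F ↔ inner ℝ a x + β = 0 := by
  classical
  obtain ⟨v0, hv0⟩ := hne
  let ι : Pt d → Pt d × ℝ := fun v => (v, 1)
  let S : Finset (Pt d × ℝ) := V.image ι
  have hS : ∀ v ∈ V, ι v ∈ S := fun v hv => Finset.mem_image_of_mem _ hv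
  have hinl : ∀ u : Pt d, (u, (0 : ℝ)) ∈ Submodule.span ℝ (S : Set (Pt d × ℝ)) := by
    have : vectorSpan ℝ (V : Set (Pt d)) ≤
        (Submodule.span ℝ (S : Set (Pt d × ℝ))).comap (LinearMap.inl ℝ (Pt d) ℝ) := by
      rw [vectorSpan_def]
      refine Submodule.span_le.2 ?_
      rintro _ ⟨v, hv, w, hw, rfl⟩
      have h1 : ι v - ι w ∈ Submodule.span ℝ (S : Set (Pt d × ℝ)) :=
        Submodule.sub_mem _ (Submodule.subset_span (hS v hv)) (Submodule.subset_span (hS w hw))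
      simpa [ι] using h1
    intro u
    rw [hV] at this
    exact this (Submodule.mem_top (x := u))
  have hspan : Submodule.span ℝ (S : Set (Pt d × ℝ)) = ⊤ := by
    rw [eq_top_iff]
    rintro ⟨u, r⟩ -
    have h1 := Submodule.add_mem _ (hinl (u - r • v0))
      (Submodule.smul_mem _ r (Submodule.subset_span (hS v0 hv0)))
    simpa [ι] using h1
  obtain ⟨f, c, hfy, hfV⟩ := geometric_hahn_banach_point_closed
    (convex_convexHull ℝ (V : Set (Pt d))) (V.finite_toSet.isClosed_convexHull ℝ) hy
  let φ0 : Module.Dual ℝ (Pt d × ℝ) :=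
    (f : Pt d →ₗ[ℝ] ℝ).comp (LinearMap.fst ℝ (Pt d) ℝ) - c • LinearMap.snd ℝ (Pt d) ℝ
  have hφ0 : ∀ x, φ0 (ι x) = f x - c := by
    intro x; simp [φ0, ι]
  obtain ⟨ψ, hψS, hψy, hker⟩ := aux_lin S hspan (ι y) (Module.finrank ℝ (Pt d × ℝ)) φ0
    (by
      intro s hs
      obtain ⟨v, hv, rfl⟩ := Finset.mem_image.1 hs
      rw [hφ0]
      linarith [hfV v (subset_convexHull ℝ _ hv)])
    (by rw [hφ0]; linarith) (by omega)
  let φ : Module.Dual ℝ (Pt d) := ψ.comp (LinearMap.inl ℝ (Pt d) ℝ)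
  let β : ℝ := ψ (0, 1)
  have hψ : ∀ (x : Pt d) (r : ℝ), ψ (x, r) = φ x + r * β := by
    intro x r
    have : (x, r) = (x, (0 : ℝ)) + r • ((0 : Pt d), (1 : ℝ)) := by simp
    rw [this, map_add, map_smul]; rfl
  have hψι : ∀ x, ψ (ι x) = φ x + β := by
    intro x; rw [hψ]; simp
  rw [hψι] at hψy
  have hφV : ∀ v ∈ V, 0 ≤ φ v + β := fun v hv => by
    rw [← hψι]; exact hψS _ (hS v hv)
  have hφne : φ ≠ 0 := by
    intro h0
    have h1 := hφV v0 hv0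
    rw [h0] at h1 hψy
    simp at h1 hψy
    linarith
  set Z : Set (Pt d) := {v | v ∈ V ∧ φ v + β = 0} with hZ
  have hfk : Module.finrank ℝ (LinearMap.ker φ) + 1 = d := by
    rw [Module.Dual.finrank_ker_add_one_of_ne_zero hφne]; simp
  have hspanZ : ∀ z0 : Pt d, ∀ p ∈ LinearMap.ker ψ, (z0 ∈ Z ∨ Z = ∅) →
      p.1 - p.2 • z0 ∈ vectorSpan ℝ Z := by
    intro z0 p hp hz0
    have hle : Submodule.span ℝ {s | s ∈ S ∧ ψ s = 0} ≤ (vectorSpan ℝ Z).comap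
        (LinearMap.fst ℝ (Pt d) ℝ - (LinearMap.snd ℝ (Pt d) ℝ).smulRight z0) := by
      refine Submodule.span_le.2 ?_
      rintro s ⟨hs, hs0⟩
      obtain ⟨v, hv, rfl⟩ := Finset.mem_image.1 hs
      have hvZ : v ∈ Z := ⟨hv, by rw [← hψι]; exact hs0⟩
      rcases hz0 with hz0 | hz0
      · have := vsub_mem_vectorSpan ℝ hvZ hz0
        simpa [ι] using this
      · rw [hz0] at hvZ; exact absurd hvZ (by simp)
    have := hle (hker hp)
    simpa using this
  have hZne : Z.Nonempty := by
    rw [nonempty_iff_ne_empty]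
    intro hemp
    have hbot : LinearMap.ker φ = ⊥ := by
      rw [eq_bot_iff]
      intro u hu
      have := hspanZ 0 (u, 0) (by
        rw [LinearMap.mem_ker, hψ, LinearMap.mem_ker.1 hu]; simp) (Or.inr hemp)
      rw [hemp, vectorSpan_empty] at this
      simpa using this
    rw [hbot, finrank_bot] at hfk
    omega
  obtain ⟨z0, hz0⟩ := hZne
  have hvs : vectorSpan ℝ Z = LinearMap.ker φ := by
    apply le_antisymm
    · rw [vectorSpan_def]
      refine Submodule.span_le.2 ?_
      rintro _ ⟨v, hv, w, hw, rfl⟩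
      have h1 := hv.2
      have h2 := hw.2
      simp only [SetLike.mem_coe, LinearMap.mem_ker, vsub_eq_sub, map_sub]
      linarith
    · intro u hu
      have := hspanZ z0 (u, 0) (by
        rw [LinearMap.mem_ker, hψ, LinearMap.mem_ker.1 hu]; simp) (Or.inl hz0)
      simpa using this
  have haff : ∀ x, x ∈ affineSpan ℝ (convexHull ℝ Z) ↔ φ x + β = 0 := by
    intro x
    rw [affineSpan_convexHull,
      ← AffineSubspace.vsub_right_mem_direction_iff_mem (subset_affineSpan ℝ Z hz0),
      direction_affineSpan, hvs, LinearMap.mem_ker, vsub_eq_sub, map_sub]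
    have := hz0.2
    constructor <;> intro h <;> linarith
  let a : Pt d := (InnerProductSpace.toDual ℝ (Pt d)).symm (LinearMap.toContinuousLinearMap φ)
  have ha : ∀ x, inner ℝ a x = φ x := by
    intro x
    simp [a, InnerProductSpace.toDual_symm_apply]
  refine ⟨a, β, convexHull ℝ Z, ?_, ?_, ?_, ⟨⟨?_, convex_convexHull ℝ _, ?_⟩, ?_⟩, ?_, ?_⟩
  · intro h0
    apply hφne
    ext x
    rw [← ha x, h0]; simp
  · intro v hv; rw [ha]; exact hφV v hv
  · rw [ha]; exact hψy
  · have := aux_face V (-φ) β (fun s hs => by have := hφV s hs; simp; linarith)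
    have hset : {s | s ∈ V ∧ (-φ) s = β} = Z := by
      ext s
      change (s ∈ V ∧ -(φ s) = β) ↔ (s ∈ V ∧ φ s + β = 0)
      constructor <;> rintro ⟨h1, h2⟩ <;> exact ⟨h1, by linarith⟩
    rwa [hset] at this
  · refine Set.Finite.isClosed_convexHull ℝ (V.finite_toSet.subset (fun s hs => hs.1))
  · unfold polyDim
    rw [← direction_affineSpan, ← direction_affineSpan, affineSpan_convexHull,
      affineSpan_convexHull, direction_affineSpan, direction_affineSpan, hvs, hV, hfk]
    simp
  · exact ⟨z0, subset_affineSpan ℝ _ (subset_convexHull ℝ _ hz0)⟩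
  · intro x; rw [ha]; exact haff x

lemma aux_basis {d : ℕ} (V : Finset (Pt d)) (hrat : ∀ v ∈ V, IsRatPt v)
    (hV : vectorSpan ℝ (V : Set (Pt d)) = ⊤) (K : ℝ)
    (hE : EdgeLengthsGT (convexHull ℝ (V : Set (Pt d))) K) :
    ∃ b : Module.Basis (Fin d) ℝ (Pt d), ∀ i, IsLatticePt (b i) ∧
      ∃ v ∈ V, ∃ w ∈ V, ∃ t : ℝ, 0 < t ∧ K < t ∧ w - v = t • b i := by
  set D : Set (Pt d) := {b | IsLatticePt b ∧
      ∃ v ∈ V, ∃ w ∈ V, ∃ t : ℝ, 0 < t ∧ K < t ∧ w - v = t • b} with hD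
  have hspan : Submodule.span ℝ D = ⊤ := by
    by_contra hcon
    obtain ⟨g, hg0, hg⟩ := Submodule.exists_le_ker_of_lt_top _ (lt_top_iff_ne_top.2 hcon)
    have hnc : ∃ v ∈ V, ∃ w ∈ V, g v ≠ g w := by
      by_contra! hc
      apply hg0
      have : vectorSpan ℝ (V : Set (Pt d)) ≤ LinearMap.ker g := by
        rw [vectorSpan_def]
        refine Submodule.span_le.2 ?_
        rintro _ ⟨v, hv, w, hw, rfl⟩
        simp [hc v hv w hw]
      rw [hV] at this
      exact LinearMap.ker_eq_top.1 (top_le_iff.1 this)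
    obtain ⟨v, hv, w, hw, hne, hext⟩ := aux_edge g V.card V le_rfl hnc
    have hvw : v ≠ w := fun h => hne (by rw [h])
    have hr : IsRatPt (w - v) := by
      intro i
      obtain ⟨p, hp⟩ := hrat v hv i
      obtain ⟨q, hq⟩ := hrat w hw i
      exact ⟨q - p, by simp [hp, hq]⟩
    obtain ⟨u, t, ht, hu, hut⟩ := aux_prim (w - v) hr (sub_ne_zero.2 hvw.symm)
    have hK := hE v w ⟨hvw, hext⟩ u t ht hu (fun i => by simpa using hut i)
    let b : Pt d := WithLp.toLp 2 (fun i => (u i : ℝ))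
    have hwv : w - v = t • b := by
      ext i; rw [hut i]; simp [b]
    have hb : b ∈ D := ⟨fun i => ⟨u i, by simp [b]⟩, v, hv, w, hw, t, ht, hK, hwv⟩
    have hgb : g b = 0 := hg (Submodule.subset_span hb)
    have : g (w - v) = 0 := by rw [hwv, map_smul, hgb, smul_zero]
    rw [map_sub] at this
    exact hne (by linarith)
  obtain ⟨f, hf, hf2, hf3⟩ := Submodule.exists_fun_fin_finrank_span_eq ℝ D
  have hfr : Module.finrank ℝ (Submodule.span ℝ D) = d := by rw [hspan, finrank_top]; simp
  have hf4 : Submodule.span ℝ (range f) = ⊤ := hf2.trans hspan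
  let b := (Module.Basis.mk hf3 hf4.ge).reindex (finCongr hfr)
  refine ⟨b, fun i => ?_⟩
  have : b i ∈ D := by simp [b, hf]
  exact this

lemma aux_normalize {d : ℕ} (P : Set (Pt d)) (hP : IsRationalPolytope P) :
    ∃ V : Finset (Pt d), (∀ v ∈ V, IsRatPt v) ∧ P = convexHull ℝ (V : Set (Pt d)) ∧
      (V : Set (Pt d)) = Set.extremePoints ℝ P := by
  obtain ⟨V0, hr, rfl⟩ := hP
  have hsub : Set.extremePoints ℝ (convexHull ℝ (V0 : Set (Pt d))) ⊆ V0 :=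
    extremePoints_convexHull_subset
  have hfin := V0.finite_toSet.subset hsub
  refine ⟨hfin.toFinset, ?_, ?_, by simp⟩
  · intro v hv
    exact hr v (hsub (by simpa using hv))
  · have h1 := closure_convexHull_extremePoints (V0.finite_toSet.isCompact_convexHull ℝ)
      (convex_convexHull ℝ (V0 : Set (Pt d)))
    rw [(hfin.isClosed_convexHull ℝ).closure_eq] at h1
    rw [hfin.coe_toFinset, h1]

/-- points far from all the facets. -/
lemma aux_inside {d : ℕ} (hd : 2 ≤ d) (V : Finset (Pt d)) (P : Set (Pt d))
    (hPV : P = convexHull ℝ (V : Set (Pt d))) (hext : (V : Set (Pt d)) = Set.extremePoints ℝ P)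
    (hV : vectorSpan ℝ (V : Set (Pt d)) = ⊤) (hne : V.Nonempty) (c : ℝ) (hc : 2 ≤ c)
    (z : Pt d) (hz : z ∈ c • P)
    (hfar : ∀ F, IsFacetOf P F → z ∉ layer (c • P) (c • F) (facetWidth P F / ((d : ℝ) + 1)))
    (b : Module.Basis (Fin d) ℝ (Pt d))
    (hb : ∀ i, ∃ v ∈ V, ∃ w ∈ V, ∃ t : ℝ, 0 < t ∧ c * d * (d + 1) < t ∧ w - v = t • b i)
    (lam : Fin d → ℝ) (hlam : ∀ i, |lam i| ≤ 1) : c⁻¹ • z + ∑ i, lam i • b i ∈ P := by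
  by_contra hcon
  have hc0 : 0 < c := by linarith
  rw [hPV] at hcon
  obtain ⟨a, β, F, ha, hVa, hya, hF, hFne, haff⟩ := aux_facet hd V hV hne _ hcon
  rw [← hPV] at hF
  have hna : 0 < ‖a‖ := norm_pos_iff.2 ha
  have hdp : (0 : ℝ) < d := by exact_mod_cast (by omega : 0 < d)
  -- width bound
  have hW : ∀ v ∈ V, inner ℝ a v + β ≤ facetWidth P F * ‖a‖ := by
    intro v hv
    have h1 : (inner ℝ a v + β) / ‖a‖ ≤ infDist v (affineSpan ℝ F : Set (Pt d)) := by
      rw [le_infDist hFne]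
      intro q hq
      have hq0 := (haff q).1 hq
      rw [div_le_iff₀ hna, dist_eq_norm]
      have h2 : inner ℝ a v + β = inner ℝ a (v - q) := by
        rw [inner_sub_right]; linarith
      rw [h2, mul_comm]
      exact real_inner_le_norm _ _
    have h2 : infDist v (affineSpan ℝ F : Set (Pt d)) ≤ facetWidth P F := by
      apply le_csSup
      · apply Set.Finite.bddAbove
        apply Set.Finite.image
        rw [← hext]; exact V.finite_toSet
      · exact ⟨v, by rw [← hext]; exact hv, rfl⟩
    exact (div_le_iff₀ hna).1 (h1.trans h2)
  set W := facetWidth P F * ‖a‖ with hWdef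
  -- distance bound
  have hf0 : 0 ≤ inner ℝ a (c⁻¹ • z) + β := by
    have hzP : c⁻¹ • z ∈ P := by
      rwa [mem_smul_set_iff_inv_smul_mem₀ hc0.ne'] at hz
    rw [hPV] at hzP
    have : convexHull ℝ (V : Set (Pt d)) ⊆ {x | -β ≤ inner ℝ a x} :=
      convexHull_min (fun v hv => by
          have := hVa v hv
          change -β ≤ inner ℝ a v
          linarith)
        (convex_halfSpace_ge (innerSL ℝ a).toLinearMap.isLinear (-β))
    have h3 : -β ≤ inner ℝ a (c⁻¹ • z) := this hzP
    linarith
  have hdist : W / (d + 1) < c * (inner ℝ a (c⁻¹ • z) + β) := by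
    have h1 : ¬ infDist z (affineSpan ℝ (c • F) : Set (Pt d)) ≤ facetWidth P F / ((d : ℝ) + 1) :=
      fun h => hfar F hF ⟨hz, h⟩
    have h1 := not_le.1 h1
    set e := inner ℝ a (c⁻¹ • z) + β with he
    let q : Pt d := c⁻¹ • z - (e / ‖a‖ ^ 2) • a
    have hq : q ∈ affineSpan ℝ F := by
      rw [haff, inner_sub_right, inner_smul_right a a, real_inner_self_eq_norm_sq,
        div_mul_cancel₀ _ (by positivity)]
      linarith
    have hcq : c • q ∈ affineSpan ℝ (c • F) := by
      have : (affineSpan ℝ F).map (c • (LinearMap.id : Pt d →ₗ[ℝ] Pt d)).toAffineMap =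
          affineSpan ℝ (c • F) := by
        rw [AffineSubspace.map_span]
        congr 1
      rw [← this]
      exact ⟨q, hq, by simp⟩
    have h2 : infDist z (affineSpan ℝ (c • F) : Set (Pt d)) ≤ c * e / ‖a‖ := by
      refine (infDist_le_dist_of_mem hcq).trans (le_of_eq ?_)
      have : z - c • q = (c * (e / ‖a‖ ^ 2)) • a := by
        simp only [q, smul_sub, smul_smul, mul_inv_cancel₀ hc0.ne', one_smul]
        abel
      rw [dist_eq_norm, this, norm_smul, Real.norm_of_nonneg (by positivity)]
      field_simp
    have h3 := h1.trans_le h2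
    rw [lt_div_iff₀ hna] at h3
    rw [hWdef]
    calc _ = facetWidth P F / ((d : ℝ) + 1) * ‖a‖ := by ring
      _ < _ := h3
  -- moves
  have hmove : ∀ i, |inner ℝ a (b i)| ≤ W / (c * d * (d + 1)) := by
    intro i
    obtain ⟨v, hv, w, hw, t, ht, hKt, hwv⟩ := hb i
    have h1 : t * inner ℝ a (b i) = inner ℝ a w - inner ℝ a v := by
      rw [← inner_smul_right, ← hwv, inner_sub_right]
    have h2 : t * |inner ℝ a (b i)| ≤ W := by
      rw [← abs_of_pos ht, ← abs_mul, h1, abs_le]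
      have := hW v hv
      have := hW w hw
      have := hVa v hv
      have := hVa w hw
      constructor <;> linarith
    rw [le_div_iff₀ (by positivity)]
    have := mul_le_mul_of_nonneg_right hKt.le (abs_nonneg (inner ℝ a (b i)))
    linarith
  have hsum : |inner ℝ a (∑ i, lam i • b i)| ≤ W / (c * (d + 1)) := by
    rw [inner_sum]
    calc |∑ i, inner ℝ a (lam i • b i)| ≤ ∑ i, |inner ℝ a (lam i • b i)| :=
          Finset.abs_sum_le_sum_abs _ _
      _ ≤ ∑ i : Fin d, W / (c * d * (d + 1)) := by
          apply Finset.sum_le_sum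
          intro i _
          rw [inner_smul_right, abs_mul]
          have := mul_le_mul_of_nonneg_right (hlam i) (abs_nonneg (inner ℝ a (b i)))
          linarith [hmove i]
      _ = W / (c * (d + 1)) := by
          simp only [Finset.sum_const, Finset.card_univ, Fintype.card_fin, nsmul_eq_mul]
          field_simp
  rw [inner_add_right] at hya
  have h5 := (abs_le.1 hsum).1
  have h6 : W / (d + 1) = c * (W / (c * (d + 1))) := by field_simp
  rw [h6] at hdist
  have := lt_of_mul_lt_mul_left hdist hc0.le
  linarith

/-- Lemma 5.1(c). If every rational `d`-polytope with edges of lattice length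
`≥ l` satisfies `BCN(d,k)`, then every rational `d`-polytope with edges of lattice length
`> max(k·d·(d+1), l)` is `k`-convex-normal. -/
theorem statement13 (d : ℕ) (hd : 2 ≤ d) (k : ℚ) (hk : 2 ≤ k) (l : ℚ)
    (hyp : ∀ Q : Set (Pt d), IsRationalPolytope Q → polyDim Q = d →
      EdgeLengthsGE Q (l : ℝ) → BCN k Q) :
    ∀ P : Set (Pt d), IsRationalPolytope P → polyDim P = d →
      EdgeLengthsGT P (max ((k : ℝ) * (d : ℝ) * ((d : ℝ) + 1)) (l : ℝ)) →
      ConvexNormal k P := by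
  intro P hP hdim hE c hc hck
  have hbcn := hyp P hP hdim (fun v w hvw u t ht hu h =>
    ((le_max_right _ _).trans_lt (hE v w hvw u t ht hu h)).le)
  obtain ⟨V, hrat, hPV, hext⟩ := aux_normalize P hP
  have hcR : (2 : ℝ) ≤ (c : ℝ) := by exact_mod_cast hc
  have hckR : (c : ℝ) ≤ (k : ℝ) := by exact_mod_cast hck
  have hPconv : Convex ℝ P := by rw [hPV]; exact convex_convexHull ℝ _
  have hVspan : vectorSpan ℝ (V : Set (Pt d)) = ⊤ := by
    apply Submodule.eq_top_of_finrank_eq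
    unfold polyDim at hdim
    rw [hPV, ← direction_affineSpan, affineSpan_convexHull, direction_affineSpan] at hdim
    rw [hdim]; simp
  have hne : V.Nonempty := by
    rw [Finset.nonempty_iff_ne_empty]
    rintro rfl
    have : vectorSpan ℝ P = ⊥ := by
      rw [hPV, Finset.coe_empty, convexHull_empty, vectorSpan_empty]
    rw [polyDim, this, finrank_bot] at hdim
    omega
  apply Subset.antisymm
  · intro z hz
    by_cases hfar : ∀ F, IsFacetOf P F →
        z ∉ layer ((c : ℝ) • P) ((c : ℝ) • F) (facetWidth P F / ((d : ℝ) + 1))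
    · obtain ⟨b, hb⟩ := aux_basis V hrat hVspan _ (hPV ▸ hE)
      have hb' : ∀ i, ∃ v ∈ V, ∃ w ∈ V, ∃ t : ℝ, 0 < t ∧ (c : ℝ) * d * (d + 1) < t ∧
          w - v = t • b i := by
        intro i
        obtain ⟨-, v, hv, w, hw, t, ht, hKt, h⟩ := hb i
        refine ⟨v, hv, w, hw, t, ht, lt_of_le_of_lt ?_ hKt, h⟩
        refine le_trans ?_ (le_max_left _ _)
        gcongr
      have hin := aux_inside hd V P hPV hext hVspan hne c hcR z hz hfar b hb'
      obtain ⟨v, hv⟩ := hne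
      have hc0 : (0 : ℝ) < c := by linarith
      have hc1 : (1 : ℝ) ≤ (c : ℝ) - 1 := by linarith
      have hc1' : (0 : ℝ) < (c : ℝ) - 1 := by linarith
      let C : ℝ := (c : ℝ)
      let x0 : Pt d := (C - 1) • C⁻¹ • z
      let r : Fin d → ℝ := fun i => b.repr (x0 - (C - 1) • v) i
      let x : Pt d := x0 + ∑ i, (-Int.fract (r i)) • b i
      have hfr : ∀ i, |Int.fract (r i)| ≤ 1 := fun i => by
        rw [abs_of_nonneg (Int.fract_nonneg _)]; exact (Int.fract_lt_one _).le
      refine ⟨v, by rw [← hext]; exact hv, x, ?_, ?_, z - x, ?_, by abel⟩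
      · rw [mem_smul_set_iff_inv_smul_mem₀ hc1'.ne']
        have h1 := hin (fun i => (C - 1)⁻¹ * (-Int.fract (r i))) (fun i => by
          rw [abs_mul, abs_neg, abs_of_pos (inv_pos.2 hc1')]
          exact mul_le_one₀ (inv_le_one_of_one_le₀ hc1) (abs_nonneg _) (hfr i))
        convert h1 using 1
        simp only [x, x0, smul_add, Finset.smul_sum, smul_smul, C]
        rw [← mul_assoc, inv_mul_cancel₀ hc1'.ne', one_mul]
      · have hx : x - (C - 1) • v = ∑ i, ((⌊r i⌋ : ℤ) : ℝ) • b i := by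
          have h1 : x0 - (C - 1) • v = ∑ i, r i • b i := (b.sum_repr _).symm
          have h2 : x - (C - 1) • v = (x0 - (C - 1) • v) + ∑ i, (-Int.fract (r i)) • b i := by
            simp only [x]; abel
          rw [h2, h1, ← Finset.sum_add_distrib]
          refine Finset.sum_congr rfl (fun i _ => ?_)
          rw [← add_smul]
          congr 1
          rw [← Int.self_sub_fract]; ring
        change IsLatticePt (x - (C - 1) • v)
        rw [hx]
        intro j
        choose m hm using fun i => (hb i).1 j
        refine ⟨∑ i, ⌊r i⌋ * m i, ?_⟩
        simp [hm]
      · have h1 := hin (fun i => Int.fract (r i)) hfr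
        convert h1 using 1
        have : z = C • C⁻¹ • z := by rw [smul_smul, mul_inv_cancel₀ hc0.ne', one_smul]
        have h3 : z - x0 = C⁻¹ • z := by
          simp only [x0, sub_smul, one_smul]
          rw [← this]; abel
        simp only [x, neg_smul, Finset.sum_neg_distrib]
        change _ = C⁻¹ • z + _
        rw [← h3]; abel
    · push Not at hfar
      obtain ⟨F, hF, hz⟩ := hfar
      exact hbcn F hF c hc hck hz
  · rintro _ ⟨v, -, x, hx, -, p, hp, rfl⟩
    have : (c : ℝ) • P = ((c : ℝ) - 1) • P + (1 : ℝ) • P := by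
      rw [← hPconv.add_smul (by linarith) zero_le_one]; congr 1; ring
    rw [this, one_smul]
    exact add_mem_add hx hp
end
end

section
/- Let d ≥ 2 be an integer, k ∈ ℚ with k ≥ 2, and l ∈ ℚ with l > 0. Assume that every rational polytope Q ⊂ ℝ^d of dimension d−1 all of whose edges have lattice length at least l satisfies, for every rational c with 2 ≤ c ≤ k + (k−1)/d, the equality cQ = ⋃ (x + Q), the union over all vertices v of Q and all x ∈ (c−1)Q ∩ ((c−1)v + ℤ^d). Then every rational polytope P ⊂ ℝ^d of dimension d all of whose edges have lattice length greater than max(k·d·(d+1), (d+1)·l/d) is k-convex-normal. -/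
open Set Metric Pointwise

noncomputable section

/-- Maximal face of a polytope in a given direction. -/
lemma mem_face_hull {d : ℕ} (V : Finset (Pt d)) (φ : Pt d →ₗ[ℝ] ℝ) (m : ℝ)
    (hm : ∀ v ∈ V, φ v ≤ m) (x : Pt d) (hx : x ∈ convexHull ℝ (V : Set (Pt d)))
    (hxm : φ x = m) : x ∈ convexHull ℝ ((V.filter (fun v => φ v = m) : Finset (Pt d)) : Set (Pt d)) := by
  obtain ⟨w, hw0, hw1, hwx⟩ := Finset.mem_convexHull'.1 hx
  have hz : ∑ y ∈ V, w y * (m - φ y) = 0 := by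
    simp only [mul_sub, Finset.sum_sub_distrib, ← Finset.sum_mul, hw1]
    have : φ x = ∑ y ∈ V, w y * φ y := by rw [← hwx]; simp
    rw [← this, hxm]; ring
  have hz' := (Finset.sum_eq_zero_iff_of_nonneg
    (fun y hy => mul_nonneg (hw0 y hy) (sub_nonneg.2 (hm y hy)))).1 hz
  have hoff : ∀ y ∈ V, ¬ (φ y = m) → w y = 0 := by
    intro y hy hne
    rcases mul_eq_zero.1 (hz' y hy) with h | h
    · exact h
    · exact absurd (by linarith) hne
  refine Finset.mem_convexHull'.2 ⟨w, fun y hy => hw0 y (Finset.mem_filter.1 hy).1, ?_, ?_⟩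
  · rw [Finset.sum_filter_of_ne, hw1]
    intro y hy hne
    by_contra h
    exact hne (hoff y hy h)
  · rw [Finset.sum_filter_of_ne, hwx]
    intro y hy hne
    by_contra h
    exact hne (by rw [hoff y hy h, zero_smul])

lemma le_on_hull {d : ℕ} (V : Finset (Pt d)) (φ : Pt d →ₗ[ℝ] ℝ) (m : ℝ)
    (hm : ∀ v ∈ V, φ v ≤ m) (x : Pt d) (hx : x ∈ convexHull ℝ (V : Set (Pt d))) : φ x ≤ m := by
  have : convexHull ℝ (V : Set (Pt d)) ⊆ {x | φ x ≤ m} :=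
    convexHull_min (fun v hv => hm v hv) (convex_halfSpace_le φ.isLinear m)
  exact this hx

lemma face_extreme {d : ℕ} (V : Finset (Pt d)) (φ : Pt d →ₗ[ℝ] ℝ) (m : ℝ)
    (hm : ∀ v ∈ V, φ v ≤ m) :
    IsExtreme ℝ (convexHull ℝ (V : Set (Pt d)))
      (convexHull ℝ ((V.filter (fun v => φ v = m) : Finset (Pt d)) : Set (Pt d))) := by
  refine ⟨convexHull_mono (fun x hx => (Finset.mem_filter.1 hx).1), ?_⟩
  intro x hx y hy z hz hzxy
  have hzm : φ z = m := by
    have : convexHull ℝ ((V.filter (fun v => φ v = m) : Finset (Pt d)) : Set (Pt d)) ⊆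
        {x | φ x = m} :=
      convexHull_min (fun v hv => (Finset.mem_filter.1 hv).2) (convex_hyperplane φ.isLinear m)
    exact this hz
  have h1 := le_on_hull V φ m hm x hx
  have h2 := le_on_hull V φ m hm y hy
  obtain ⟨a, b, ha, hb, hab, rfl⟩ := hzxy
  refine mem_face_hull V φ m hm x hx ?_
  simp only [map_add, map_smul, smul_eq_mul] at hzm
  have : a * (m - φ x) + b * (m - φ y) = 0 := by
    have : a * m + b * m = m := by rw [← add_mul, hab, one_mul]
    linarith
  have h3 : 0 ≤ b * (m - φ y) := mul_nonneg hb.le (by linarith)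
  nlinarith

/-- If `ψ` is nonconstant on the vertices, there is an edge on which `ψ` is nonconstant. -/
lemma exists_edge {d : ℕ} (V : Finset (Pt d)) (ψ : Pt d →ₗ[ℝ] ℝ)
    (hψ : ∃ a ∈ V, ∃ b ∈ V, ψ a ≠ ψ b) :
    ∃ a ∈ V, ∃ b ∈ V, ψ a ≠ ψ b ∧
      IsExtreme ℝ (convexHull ℝ (V : Set (Pt d))) (segment ℝ a b) := by
  classical
  let S : Finset (Finset (Pt d)) := V.powerset.filter (fun W : Finset (Pt d) => IsExtreme ℝ (convexHull ℝ (V : Set (Pt d)))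
    (convexHull ℝ (W : Set (Pt d))) ∧ ∃ a ∈ W, ∃ b ∈ W, ψ a ≠ ψ b)
  have hS : S.Nonempty := ⟨V, by simp only [S, Finset.mem_filter]; simpa using ⟨IsExtreme.rfl, hψ⟩⟩
  obtain ⟨W, hWS, hWmin⟩ := Finset.exists_min_image S Finset.card hS
  simp only [S, Finset.mem_filter, Finset.mem_powerset] at hWS hWmin
  obtain ⟨hWV, hWext, a0, ha0, b0, hb0, hab0⟩ := hWS
  obtain ⟨a, haW, hamax⟩ := Finset.exists_max_image W ψ ⟨a0, ha0⟩
  obtain ⟨b, hbW, hbmin⟩ := Finset.exists_min_image W ψ ⟨a0, ha0⟩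
  have hba : ψ b < ψ a := by
    by_contra h
    have e1 := hamax a0 ha0
    have e2 := hamax b0 hb0
    have e3 := hbmin a0 ha0
    have e4 := hbmin b0 hb0
    exact hab0 (by linarith)
  have key : ∀ φ : Pt d →ₗ[ℝ] ℝ, ∃ t m : ℝ, ∀ x ∈ W, φ x + t * ψ x = m := by
    intro φ
    obtain ⟨a1, ha1, ha1max⟩ := Finset.exists_max_image (W.filter (fun x => ψ x = ψ a)) φ
      ⟨a, by simp [haW]⟩
    obtain ⟨b1, hb1, hb1max⟩ := Finset.exists_max_image (W.filter (fun x => ψ x ≠ ψ a))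
      (fun x => (φ x - φ a1) / (ψ a - ψ x)) ⟨b, by simp [hbW, hba.ne]⟩
    simp only [Finset.mem_filter] at ha1 ha1max hb1 hb1max
    set t := (φ b1 - φ a1) / (ψ a - ψ b1) with ht
    have hb1lt : 0 < ψ a - ψ b1 := sub_pos.2 (lt_of_le_of_ne (hamax b1 hb1.1) hb1.2)
    refine ⟨t, φ a1 + t * ψ a, ?_⟩
    have hle : ∀ v ∈ W, (φ + t • ψ) v ≤ φ a1 + t * ψ a := by
      intro v hv
      simp only [LinearMap.add_apply, LinearMap.smul_apply, smul_eq_mul]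
      by_cases h : ψ v = ψ a
      · rw [h]; linarith [ha1max v ⟨hv, h⟩]
      · have hvlt : 0 < ψ a - ψ v := sub_pos.2 (lt_of_le_of_ne (hamax v hv) h)
        have := hb1max v ⟨hv, h⟩
        rw [div_le_iff₀ hvlt] at this
        linarith
    have hface := face_extreme W (φ + t • ψ) _ hle
    have hcard := hWmin (W.filter (fun v => (φ + t • ψ) v = φ a1 + t * ψ a))
      ⟨(Finset.filter_subset _ _).trans hWV, hWext.trans hface, a1, ?_, b1, ?_, ?_⟩
    · intro x hx
      have heq := Finset.eq_of_subset_of_card_le (Finset.filter_subset _ _) hcard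
      rw [← heq] at hx
      have := (Finset.mem_filter.1 hx).2
      simpa using this
    · simp [ha1.1, ha1.2]
    · simp only [Finset.mem_filter, hb1.1, true_and, LinearMap.add_apply, LinearMap.smul_apply,
        smul_eq_mul]
      have : t * (ψ a - ψ b1) = φ b1 - φ a1 := by rw [ht]; field_simp
      linarith
    · rw [ha1.2]; exact fun h => hb1.2 h.symm
  have hseg : convexHull ℝ (W : Set (Pt d)) = segment ℝ a b := by
    apply Subset.antisymm
    · refine convexHull_min ?_ (convex_segment a b)
      intro x hx
      have hx : x ∈ W := hx
      have hpos : 0 < ψ a - ψ b := by linarith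
      have h1 := hamax x hx
      have h2 := hbmin x hx
      refine ⟨(ψ x - ψ b) / (ψ a - ψ b), (ψ a - ψ x) / (ψ a - ψ b),
        div_nonneg (by linarith) hpos.le, div_nonneg (by linarith) hpos.le, by field_simp; ring, ?_⟩
      ext i
      obtain ⟨t, m, h⟩ := key (EuclideanSpace.proj i : Pt d →L[ℝ] ℝ).toLinearMap
      have e1 := h x hx
      have e2 := h a haW
      have e3 := h b hbW
      simp at e1 e2 e3 ⊢
      field_simp
      have e4 : a.ofLp i = m - t * ψ a := by linarith
      have e5 : b.ofLp i = m - t * ψ b := by linarith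
      have e6 : x.ofLp i = m - t * ψ x := by linarith
      rw [e4, e5, e6]; ring
    · rw [← convexHull_pair]
      refine convexHull_mono ?_
      intro x hx
      rcases hx with rfl | rfl
      · exact haW
      · exact hbW
  exact ⟨a, hWV haW, b, hWV hbW, hba.ne', hseg ▸ hWext⟩

/-- A supporting functional can be rotated to a facet. -/
lemma exists_facet {d : ℕ} (V : Finset (Pt d)) (hV : vectorSpan ℝ (V : Set (Pt d)) = ⊤)
    (f : Pt d) (hf : f ∈ convexHull ℝ (V : Set (Pt d)))
    (hφ : ∃ φ : Pt d →ₗ[ℝ] ℝ, φ ≠ 0 ∧ ∀ v ∈ V, φ v ≤ φ f) :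
    ∃ W : Finset (Pt d), W ⊆ V ∧ f ∈ convexHull ℝ (W : Set (Pt d)) ∧
      IsExtreme ℝ (convexHull ℝ (V : Set (Pt d))) (convexHull ℝ (W : Set (Pt d))) ∧
      Module.finrank ℝ (vectorSpan ℝ (W : Set (Pt d))) + 1 = d := by
  classical
  let S : Finset (Finset (Pt d)) := V.powerset.filter (fun W : Finset (Pt d) => ∃ φ : Pt d →ₗ[ℝ] ℝ, φ ≠ 0 ∧ (∀ v ∈ V, φ v ≤ φ f) ∧
    W = V.filter (fun v => φ v = φ f))
  have hS : S.Nonempty := by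
    obtain ⟨φ, h0, h1⟩ := hφ
    exact ⟨V.filter (fun v => φ v = φ f), by
      simp only [S, Finset.mem_filter, Finset.mem_powerset]
      exact ⟨Finset.filter_subset _ _, φ, h0, h1, rfl⟩⟩
  obtain ⟨W, hWS, hWmax⟩ := Finset.exists_max_image S Finset.card hS
  simp only [S, Finset.mem_filter, Finset.mem_powerset] at hWS hWmax
  obtain ⟨hWV, φ, hφ0, hφle, hWeq⟩ := hWS
  have hfW : f ∈ convexHull ℝ (W : Set (Pt d)) := by
    rw [hWeq]; exact mem_face_hull V φ _ hφle f hf rfl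
  have hfvec : ∀ v ∈ W, v - f ∈ vectorSpan ℝ (W : Set (Pt d)) := by
    intro v hv
    have h1 : f ∈ affineSpan ℝ (W : Set (Pt d)) := convexHull_subset_affineSpan _ hfW
    have h2 : v ∈ affineSpan ℝ (W : Set (Pt d)) := subset_affineSpan _ _ hv
    have := AffineSubspace.vsub_mem_direction h2 h1
    rwa [direction_affineSpan] at this
  refine ⟨W, hWV, hfW, ?_, ?_⟩
  · rw [hWeq]; exact face_extreme V φ _ hφle
  have hker : vectorSpan ℝ (W : Set (Pt d)) = LinearMap.ker φ := by
    apply le_antisymm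
    · rw [vectorSpan_def, Submodule.span_le]
      rintro _ ⟨x, hx, y, hy, rfl⟩
      have hx : x ∈ W := hx
      have hy : y ∈ W := hy
      rw [hWeq, Finset.mem_filter] at hx hy
      simp [hx.2, hy.2]
    · intro x hxker
      by_contra hxW
      obtain ⟨ψ0, hψx0, hψW0⟩ := Submodule.exists_le_ker_of_notMem hxW
      have hex : ∃ v ∈ V, ψ0 v ≠ ψ0 f := by
        by_contra hcon
        push Not at hcon
        have : vectorSpan ℝ (V : Set (Pt d)) ≤ LinearMap.ker ψ0 := by
          rw [vectorSpan_def, Submodule.span_le]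
          rintro _ ⟨x, hx, y, hy, rfl⟩
          simp [hcon x hx, hcon y hy]
        rw [hV] at this
        exact hψx0 (this (Submodule.mem_top (x := x)))
      obtain ⟨ψ, hψx, hψW, v0, hv0, hv0pos⟩ : ∃ ψ : Pt d →ₗ[ℝ] ℝ, ψ x ≠ 0 ∧
          vectorSpan ℝ (W : Set (Pt d)) ≤ LinearMap.ker ψ ∧ ∃ v ∈ V, ψ f < ψ v := by
        obtain ⟨v, hv, hne⟩ := hex
        rcases lt_or_gt_of_ne hne with h | h
        · refine ⟨-ψ0, by simpa using hψx0, ?_, v, hv, by simpa using h⟩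
          intro y hy
          have := hψW0 hy
          simp at this ⊢; exact this
        · exact ⟨ψ0, hψx0, hψW0, v, hv, h⟩
      have hWψ : ∀ v ∈ W, ψ v = ψ f := by
        intro v hv
        have := hψW (hfvec v hv)
        simpa [sub_eq_zero] using this
      obtain ⟨v1, hv1, hv1min⟩ := Finset.exists_min_image (V.filter (fun v => ψ f < ψ v))
        (fun v => (φ f - φ v) / (ψ v - ψ f)) ⟨v0, by simp [hv0, hv0pos]⟩
      simp only [Finset.mem_filter] at hv1 hv1min
      set t := (φ f - φ v1) / (ψ v1 - ψ f) with ht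
      have hp1 : 0 < ψ v1 - ψ f := by linarith [hv1.2]
      have ht0 : 0 ≤ t := div_nonneg (by linarith [hφle v1 hv1.1]) hp1.le
      have hv1W : v1 ∉ W := fun h => by linarith [hWψ v1 h, hv1.2]
      have hle : ∀ v ∈ V, (φ + t • ψ) v ≤ (φ + t • ψ) f := by
        intro v hv
        simp only [LinearMap.add_apply, LinearMap.smul_apply, smul_eq_mul]
        by_cases h : ψ f < ψ v
        · have := hv1min v ⟨hv, h⟩
          rw [le_div_iff₀ (by linarith)] at this
          linarith
        · have := hφle v hv
          nlinarith
      have hne : φ + t • ψ ≠ 0 := by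
        intro h0
        by_cases h : t = 0
        · simp [h] at h0; exact hφ0 h0
        · have := congrArg (fun g => g x) h0
          have hx0 : φ x = 0 := hxker
          simp [hx0, h, hψx] at this
      have hcard := hWmax (V.filter (fun v => (φ + t • ψ) v = (φ + t • ψ) f))
        ⟨Finset.filter_subset _ _, _, hne, hle, rfl⟩
      have hsub : insert v1 W ⊆ V.filter (fun v => (φ + t • ψ) v = (φ + t • ψ) f) := by
        intro v hv
        rw [Finset.mem_insert] at hv
        simp only [Finset.mem_filter, LinearMap.add_apply, LinearMap.smul_apply, smul_eq_mul]
        rcases hv with rfl | hv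
        · refine ⟨hv1.1, ?_⟩
          have : t * (ψ v - ψ f) = φ f - φ v := by rw [ht]; field_simp
          linarith
        · have h2 := hWψ v hv
          rw [hWeq, Finset.mem_filter] at hv
          exact ⟨hv.1, by rw [hv.2, h2]⟩
      have := Finset.card_le_card hsub
      rw [Finset.card_insert_of_notMem hv1W] at this
      omega
  rw [hker]
  have := Module.Dual.finrank_ker_add_one_of_ne_zero (f := φ) hφ0
  rw [this]; simp

/-- Leaving the polytope along a segment happens through a facet. -/
lemma exit_facet {d : ℕ} (V : Finset (Pt d)) (hV : vectorSpan ℝ (V : Set (Pt d)) = ⊤)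
    (p g : Pt d) (hp : p ∈ convexHull ℝ (V : Set (Pt d)))
    (hg : g ∉ convexHull ℝ (V : Set (Pt d))) :
    ∃ f ∈ segment ℝ p g, ∃ W : Finset (Pt d), W ⊆ V ∧ f ∈ convexHull ℝ (W : Set (Pt d)) ∧
      IsExtreme ℝ (convexHull ℝ (V : Set (Pt d))) (convexHull ℝ (W : Set (Pt d))) ∧
      Module.finrank ℝ (vectorSpan ℝ (W : Set (Pt d))) + 1 = d := by
  have hcl : IsClosed (convexHull ℝ (V : Set (Pt d))) :=
    (V.finite_toSet.isCompact_convexHull ℝ).isClosed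
  have hconv := convex_convexHull ℝ (V : Set (Pt d))
  have hne : (V : Set (Pt d)).Nonempty := convexHull_nonempty_iff.1 ⟨p, hp⟩
  have hint : (interior (convexHull ℝ (V : Set (Pt d)))).Nonempty := by
    rw [interior_convexHull_nonempty_iff_affineSpan_eq_top]
    exact (AffineSubspace.affineSpan_eq_top_iff_vectorSpan_eq_top_of_nonempty ℝ _ _ hne).2 hV
  obtain ⟨f, hfs, hff⟩ : (segment ℝ p g ∩ frontier (convexHull ℝ (V : Set (Pt d)))).Nonempty := by
    by_contra hcon
    have := (convex_segment (𝕜 := ℝ) p g).isPreconnected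
    have hh := isPreconnected_iff_subset_of_disjoint.1 this
      (interior (convexHull ℝ (V : Set (Pt d)))) (convexHull ℝ (V : Set (Pt d)))ᶜ
      isOpen_interior hcl.isOpen_compl ?_ ?_
    · rcases hh with h | h
      · exact hg (interior_subset (h (right_mem_segment ℝ p g)))
      · exact h (left_mem_segment ℝ p g) hp
    · intro x hx
      by_cases h : x ∈ convexHull ℝ (V : Set (Pt d))
      · left
        by_contra h2
        exact hcon ⟨x, hx, by rw [hcl.frontier_eq]; exact ⟨h, h2⟩⟩
      · right; exact h
    · ext x
      simp only [mem_inter_iff, mem_compl_iff, mem_empty_iff_false, iff_false]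
      rintro ⟨_, h1, h2⟩
      exact h2 (interior_subset h1)
  rw [hcl.frontier_eq] at hff
  obtain ⟨φ, hφ⟩ := geometric_hahn_banach_open_point hconv.interior isOpen_interior hff.2
  refine ⟨f, hfs, exists_facet V hV f hff.1 ⟨φ.toLinearMap, ?_, ?_⟩⟩
  · intro h0
    obtain ⟨a, ha⟩ := hint
    have := hφ a ha
    have e : ∀ x, φ x = 0 := fun x => congrArg (fun g => g x) h0
    rw [e, e] at this
    exact lt_irrefl _ this
  · intro v hv
    have hv' : v ∈ closure (interior (convexHull ℝ (V : Set (Pt d)))) := by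
      rw [hconv.closure_interior_eq_closure_of_nonempty_interior hint]
      exact subset_closure (subset_convexHull ℝ _ hv)
    have : closure (interior (convexHull ℝ (V : Set (Pt d)))) ⊆ {x | φ x ≤ φ f} :=
      closure_minimal (fun x hx => (hφ x hx).le) (isClosed_le φ.continuous continuous_const)
    exact this hv'

lemma exists_prim_dir {d : ℕ} (a b : Pt d) (ha : IsRatPt a) (hb : IsRatPt b) (hab : a ≠ b) :
    ∃ (u : Fin d → ℤ) (t : ℝ), 0 < t ∧ IsPrimitive u ∧ ∀ i, b i - a i = t * (u i : ℝ) := by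
  choose qa hqa using ha
  choose qb hqb using hb
  let q : Fin d → ℚ := fun i => qb i - qa i
  let D : ℕ := ∏ i, (q i).den
  have hD : 0 < D := Finset.prod_pos (fun i _ => (q i).den_pos)
  have hn : ∀ i, ∃ n : ℤ, (n : ℚ) = q i * D := by
    intro i
    obtain ⟨e, he⟩ : (q i).den ∣ D := Finset.dvd_prod_of_mem (fun i => (q i).den) (Finset.mem_univ i)
    refine ⟨(q i).num * e, ?_⟩
    rw [he]
    push_cast
    rw [← mul_assoc, Rat.mul_den_eq_num]
  choose n hn using hn
  have hne : ∃ i, n i ≠ 0 := by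
    by_contra hcon
    push Not at hcon
    apply hab
    ext i
    have h := hn i
    rw [hcon i] at h
    have hD' : (D : ℚ) ≠ 0 := by exact_mod_cast hD.ne'
    have hq : q i = 0 := by
      rcases mul_eq_zero.1 h.symm with h | h
      · exact h
      · exact absurd h hD'
    rw [hqa, hqb]
    have : qb i - qa i = 0 := hq
    have : qb i = qa i := by linarith
    rw [this]
  obtain ⟨i0, hi0⟩ := hne
  obtain ⟨u, hu, hgu⟩ := Finset.extract_gcd (s := Finset.univ) n ⟨i0, Finset.mem_univ _⟩
  set g := Finset.univ.gcd n with hg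
  have hg0 : 0 < g := by
    have h1 : 0 ≤ g := by
      have : normalize g = g := Finset.normalize_gcd
      rw [← this]
      rw [← Int.abs_eq_normalize]; exact abs_nonneg g
    refine lt_of_le_of_ne h1 ?_
    intro h
    apply hi0
    rw [hu i0 (Finset.mem_univ _), ← h, zero_mul]
  have hDR : (0 : ℝ) < D := by exact_mod_cast hD
  refine ⟨u, (g : ℝ) / D, div_pos (by exact_mod_cast hg0) hDR, hgu, ?_⟩
  intro i
  have h1 : (n i : ℚ) = (qb i - qa i) * D := hn i
  rw [hu i (Finset.mem_univ _)] at h1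
  have h2 : ((g : ℝ) * (u i : ℝ)) = ((qb i : ℝ) - qa i) * D := by exact_mod_cast h1
  rw [hqa, hqb]
  field_simp
  linarith

lemma isExtreme_unscale {d : ℕ} (ρ : ℝ) (hρ : 0 < ρ) (F B : Set (Pt d))
    (h : IsExtreme ℝ (ρ • F) (ρ • B)) : IsExtreme ℝ F B := by
  constructor
  · intro x hx
    exact (smul_mem_smul_set_iff₀ hρ.ne' F x).1 (h.subset (smul_mem_smul_set hx))
  · intro x hx y hy z hz hzxy
    refine (smul_mem_smul_set_iff₀ hρ.ne' B x).1 (h.left_mem_of_mem_openSegment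
      (smul_mem_smul_set hx) (smul_mem_smul_set hy) (smul_mem_smul_set hz) ?_)
    obtain ⟨a, b, ha, hb, hab, rfl⟩ := hzxy
    exact ⟨a, b, ha, hb, hab, by module⟩

lemma segment_scale {d : ℕ} (ρ : ℝ) (v w : Pt d) :
    segment ℝ (ρ • v) (ρ • w) = ρ • segment ℝ v w := by
  rw [← convexHull_pair, ← convexHull_pair, ← convexHull_smul]
  congr 1
  rw [← image_smul, image_pair]

lemma extremePoint_unscale {d : ℕ} (ρ : ℝ) (hρ : 0 < ρ) (F : Set (Pt d)) (v : Pt d)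
    (hv : v ∈ Set.extremePoints ℝ (ρ • F)) :
    ∃ v' ∈ Set.extremePoints ℝ F, v = ρ • v' := by
  obtain ⟨v', hv', rfl⟩ := hv.1
  refine ⟨v', ?_, rfl⟩
  rw [← isExtreme_singleton] at hv ⊢
  apply isExtreme_unscale ρ hρ
  rwa [smul_set_singleton]

lemma pyramid_step (d : ℕ) (hd : 2 ≤ d) (k : ℚ) (l : ℚ)
    (hyp : ∀ Q : Set (Pt d), IsRationalPolytope Q → polyDim Q = d - 1 →
      EdgeLengthsGE Q (l : ℝ) →
      ∀ c : ℚ, 2 ≤ c → c ≤ k + (k - 1) / (d : ℚ) → (c : ℝ) • Q = cnUnion Q (c : ℝ))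
    (V W : Finset (Pt d)) (hVrat : ∀ v ∈ V, IsRatPt v) (hWV : W ⊆ V)
    (hedge : EdgeLengthsGT (convexHull ℝ (V : Set (Pt d))) (((d : ℝ) + 1) * (l : ℝ) / (d : ℝ)))
    (hext : IsExtreme ℝ (convexHull ℝ (V : Set (Pt d))) (convexHull ℝ (W : Set (Pt d))))
    (hdim : Module.finrank ℝ (vectorSpan ℝ (W : Set (Pt d))) + 1 = d)
    (c : ℚ) (hc2 : 2 ≤ c) (hck : c ≤ k) (f w : Pt d) (hf : f ∈ convexHull ℝ (W : Set (Pt d)))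
    (hw : w ∈ convexHull ℝ (V : Set (Pt d))) (s : ℝ) (hs0 : 0 ≤ s)
    (hs : s * (c * ((d : ℝ) + 1)) ≤ 1) :
    (c : ℝ) • ((1 - s) • f + s • w) ∈ cnUnion (convexHull ℝ (V : Set (Pt d))) (c : ℝ) := by
  classical
  have hdR : (2 : ℝ) ≤ d := by exact_mod_cast hd
  have hdQ : (2 : ℚ) ≤ d := by exact_mod_cast hd
  have hcR : (2 : ℝ) ≤ c := by exact_mod_cast hc2
  let ρq : ℚ := d / (d + 1)
  set ρ : ℝ := (d : ℝ) / (d + 1) with hρdef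
  have hρq : (ρq : ℝ) = ρ := by simp [ρq, hρdef]
  have hρ : 0 < ρ := by positivity
  set F := convexHull ℝ (W : Set (Pt d)) with hF
  have hQrat : IsRationalPolytope (ρ • F) := by
    refine ⟨W.image (fun x => ρ • x), ?_, ?_⟩
    · intro v hv
      obtain ⟨x, hx, rfl⟩ := Finset.mem_image.1 hv
      intro i
      obtain ⟨q, hq⟩ := hVrat x (hWV hx) i
      exact ⟨ρq * q, by push_cast; rw [hρq, ← hq]; simp⟩
    · rw [hF, ← convexHull_smul, Finset.coe_image, image_smul]
  have hQdim : polyDim (ρ • F) = d - 1 := by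
    have h1 : vectorSpan ℝ F = vectorSpan ℝ (W : Set (Pt d)) := by
      rw [← direction_affineSpan, hF, affineSpan_convexHull, direction_affineSpan]
    have h2 : vectorSpan ℝ (ρ • F) = Submodule.map
        (LinearEquiv.smulOfNeZero ℝ (Pt d) ρ hρ.ne' : Pt d →ₗ[ℝ] Pt d) (vectorSpan ℝ F) := by
      have := AffineMap.map_vectorSpan
        (LinearEquiv.smulOfNeZero ℝ (Pt d) ρ hρ.ne' : Pt d →ₗ[ℝ] Pt d).toAffineMap (s := F)
      rw [LinearMap.toAffineMap_linear] at this
      rw [this]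
      rfl
    rw [polyDim, h2, LinearEquiv.finrank_map_eq, h1]
    omega
  have hQedge : EdgeLengthsGE (ρ • F) (l : ℝ) := by
    intro v0 w0 hvw u t ht hu hut
    have hv0 : v0 = ρ • (ρ⁻¹ • v0) := by rw [smul_smul, mul_inv_cancel₀ hρ.ne', one_smul]
    have hw0 : w0 = ρ • (ρ⁻¹ • w0) := by rw [smul_smul, mul_inv_cancel₀ hρ.ne', one_smul]
    obtain ⟨hne, he⟩ := hvw
    have hedge' : IsEdge (convexHull ℝ (V : Set (Pt d))) (ρ⁻¹ • v0) (ρ⁻¹ • w0) := by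
      refine ⟨fun h => hne (by rw [hv0, hw0, h]), hext.trans ?_⟩
      apply isExtreme_unscale ρ hρ
      rw [← segment_scale, ← hv0, ← hw0]
      exact he
    have := hedge _ _ hedge' u (ρ⁻¹ * t) (by positivity) hu (by
      intro i
      simp only [PiLp.smul_apply, smul_eq_mul]
      rw [← mul_sub, hut i]; ring)
    have h3 : ρ * (((d : ℝ) + 1) * (l : ℝ) / (d : ℝ)) < ρ * (ρ⁻¹ * t) :=
      mul_lt_mul_of_pos_left this hρ
    rw [← mul_assoc, mul_inv_cancel₀ hρ.ne', one_mul] at h3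
    have h4 : ρ * (((d : ℝ) + 1) * (l : ℝ) / (d : ℝ)) = l := by
      rw [hρdef]; field_simp
    linarith
  let c' : ℚ := c + (c - 1) / d
  have hc'R : (c' : ℝ) = c + (c - 1) / d := by simp [c']
  have hQ := hyp (ρ • F) hQrat hQdim hQedge c' (by
      have : 0 ≤ (c - 1) / (d : ℚ) := div_nonneg (by linarith) (by linarith)
      simp only [c']; linarith) (by
      have : (c - 1) / (d : ℚ) ≤ (k - 1) / d := by gcongr
      simp only [c']; linarith)
  have hmem : (c' : ℝ) • ρ • f ∈ (c' : ℝ) • ρ • F :=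
    smul_mem_smul_set (smul_mem_smul_set hf)
  rw [hQ] at hmem
  obtain ⟨v, hv, x, hx, hlat, q, hq, hsum⟩ := hmem
  obtain ⟨v', hv', rfl⟩ := extremePoint_unscale ρ hρ F v hv
  have hmul : ((c' : ℝ) - 1) * ρ = c - 1 := by
    rw [hc'R, hρdef]; field_simp; ring
  have hFP : F ⊆ convexHull ℝ (V : Set (Pt d)) := hext.subset
  rw [smul_smul, hmul] at hx hlat
  obtain ⟨q', hq', rfl⟩ := hq
  obtain ⟨x', hx', rfl⟩ := hx
  refine ⟨v', hext.extremePoints_subset_extremePoints hv', _, ⟨x', hFP hx', rfl⟩, hlat,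
    ρ • q' + (1 - c * s - ρ) • f + (c * s) • w, ?_, ?_⟩
  · have hcs : c * s ≤ 1 - ρ := by
      have : (1 : ℝ) - ρ = 1 / (d + 1) := by rw [hρdef]; field_simp; ring
      rw [this, le_div_iff₀ (by linarith)]
      linarith
    have hz : ∀ i ∈ (Finset.univ : Finset (Fin 3)), (![q', f, w] : Fin 3 → Pt d) i ∈
        convexHull ℝ (V : Set (Pt d)) := by
      intro i _
      fin_cases i
      · exact hFP hq'
      · exact hFP hf
      · exact hw
    have := (convex_convexHull ℝ (V : Set (Pt d))).sum_mem (t := Finset.univ)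
      (w := ![ρ, 1 - c * s - ρ, c * s]) (z := ![q', f, w]) (by
        intro i _
        fin_cases i
        · exact hρ.le
        · show 0 ≤ 1 - c * s - ρ
          linarith
        · show 0 ≤ (c : ℝ) * s
          positivity) (by
        simp [Fin.sum_univ_three]) hz
    simpa [Fin.sum_univ_three] using this
  · have hc'ρ : (c' : ℝ) * ρ = c - 1 + ρ := by linarith
    rw [smul_smul, hc'ρ] at hsum
    have e : (c : ℝ) • ((1 - s) • f + s • w) =
        ((c : ℝ) - 1 + ρ) • f + (1 - c * s - ρ) • f + (c * s) • w := by module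
    rw [e, hsum]
    simp only [add_assoc]

lemma deep_step (d : ℕ) (hd : 2 ≤ d) (k : ℚ)
    (V : Finset (Pt d)) (hVrat : ∀ v ∈ V, IsRatPt v)
    (hV : vectorSpan ℝ (V : Set (Pt d)) = ⊤)
    (hedge : EdgeLengthsGT (convexHull ℝ (V : Set (Pt d))) ((k : ℝ) * (d : ℝ) * ((d : ℝ) + 1)))
    (c : ℚ) (hc2 : 2 ≤ c) (hck : c ≤ k) (p : Pt d) (hp : p ∈ convexHull ℝ (V : Set (Pt d)))
    (hdeep : ∀ a ∈ convexHull ℝ (V : Set (Pt d)), ∀ b ∈ convexHull ℝ (V : Set (Pt d)),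
      p + (1 / ((c : ℝ) * (d + 1))) • (a - b) ∈ convexHull ℝ (V : Set (Pt d))) :
    (c : ℝ) • p ∈ cnUnion (convexHull ℝ (V : Set (Pt d))) (c : ℝ) := by
  classical
  have hdR : (2 : ℝ) ≤ d := by exact_mod_cast hd
  have hcR : (2 : ℝ) ≤ c := by exact_mod_cast hc2
  have hckR : (c : ℝ) ≤ k := by exact_mod_cast hck
  set P := convexHull ℝ (V : Set (Pt d)) with hP
  have hconv : Convex ℝ P := convex_convexHull ℝ _
  -- edge direction vectors
  let E : Set (Pt d) := {e | ∃ a ∈ V, ∃ b ∈ V, IsEdge P a b ∧ e = b - a}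
  have hspan : Submodule.span ℝ E = ⊤ := by
    by_contra hne
    obtain ⟨ψ, hψ0, hψ⟩ := Submodule.exists_le_ker_of_lt_top _ (lt_top_iff_ne_top.2 hne)
    by_cases hcon : ∃ a ∈ V, ∃ b ∈ V, ψ a ≠ ψ b
    · obtain ⟨a, ha, b, hb, hab, hex⟩ := exists_edge V ψ hcon
      have : b - a ∈ LinearMap.ker ψ := hψ (Submodule.subset_span
        ⟨a, ha, b, hb, ⟨fun h => hab (by rw [h]), hex⟩, rfl⟩)
      simp [sub_eq_zero] at this
      exact hab this.symm
    · push Not at hcon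
      apply hψ0
      have : vectorSpan ℝ (V : Set (Pt d)) ≤ LinearMap.ker ψ := by
        rw [vectorSpan_def, Submodule.span_le]
        rintro _ ⟨x, hx, y, hy, rfl⟩
        simp [hcon x hx y hy]
      rw [hV, top_le_iff] at this
      exact LinearMap.ker_eq_top.1 this
  obtain ⟨e, heE, hespan⟩ : ∃ e : Fin d → Pt d, (∀ i, e i ∈ E) ∧
      Submodule.span ℝ (Set.range e) = ⊤ := by
    obtain ⟨e, h1, h2, -⟩ := Submodule.exists_fun_fin_finrank_span_eq ℝ E
    have hfr : Module.finrank ℝ (Submodule.span ℝ E) = d := by rw [hspan]; simp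
    refine ⟨e ∘ Fin.cast hfr.symm, fun i => h1 _, ?_⟩
    have h3 : Set.range (e ∘ Fin.cast hfr.symm) = Set.range e :=
      (finCongr hfr.symm).surjective.range_comp e
    rw [h3]
    exact h2.trans hspan
  choose a ha b hb hE heab using heE
  have hdir := fun i => exists_prim_dir (a i) (b i) (hVrat _ (ha i)) (hVrat _ (hb i)) (hE i).1
  choose u m hm hu hum using hdir
  have hmgt : ∀ i, (k : ℝ) * d * (d + 1) < m i := fun i =>
    hedge _ _ (hE i) (u i) (m i) (hm i) (hu i) (hum i)
  let U : Fin d → Pt d := fun i => WithLp.toLp 2 (fun j => (u i j : ℝ))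
  have heU : ∀ i, e i = m i • U i := by
    intro i
    ext j
    rw [heab i]
    simpa [U] using hum i j
  -- box around p
  have hbox : ∀ θ : Fin d → ℝ, (∀ i, |θ i| ≤ 1) → p + ∑ i, θ i • U i ∈ P := by
    intro θ hθ
    have hpt : ∀ i, p + (d * θ i) • U i ∈ P := by
      intro i
      have haP : a i ∈ P := subset_convexHull ℝ _ (ha i)
      have hbP : b i ∈ P := subset_convexHull ℝ _ (hb i)
      set s0 : ℝ := 1 / ((c : ℝ) * (d + 1)) with hs0
      have hs0pos : 0 < s0 := by positivity
      have h1 := hdeep _ hbP _ haP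
      have h2 := hdeep _ haP _ hbP
      have e1 : b i - a i = m i • U i := by rw [← heab, heU]
      have e2 : a i - b i = -(m i • U i) := by rw [← e1]; abel
      rw [e1] at h1
      rw [e2] at h2
      have hbig : (d : ℝ) ≤ s0 * m i := by
        rw [hs0, one_div, ← div_eq_inv_mul, le_div_iff₀ (by positivity)]
        have : (c : ℝ) * (d * (d + 1)) ≤ k * (d * (d + 1)) := by gcongr
        linarith [hmgt i]
      have hs0m : 0 < s0 * m i := by linarith
      have habs := abs_le.1 (hθ i)
      set r : ℝ := d * θ i / (s0 * m i) with hr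
      have hr1 : r ≤ 1 := by
        rw [hr, div_le_one hs0m]; nlinarith
      have hr2 : -1 ≤ r := by
        rw [hr, le_div_iff₀ hs0m]; nlinarith
      have hcomb := hconv h1 h2 (a := (1 + r) / 2) (b := (1 - r) / 2) (by linarith) (by linarith)
        (by ring)
      have hrm : r * (s0 * m i) = d * θ i := div_mul_cancel₀ _ hs0m.ne'
      convert hcomb using 1
      rw [← hrm]
      module
    have := hconv.sum_mem (t := Finset.univ) (w := fun _ : Fin d => (1 : ℝ) / d)
      (z := fun i => p + (d * θ i) • U i) (fun i _ => by positivity)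
      (by simp; field_simp) (fun i _ => hpt i)
    convert this using 1
    simp only [smul_add, Finset.sum_add_distrib, smul_smul]
    congr 1
    · simp [← Nat.cast_smul_eq_nsmul ℝ, smul_smul]
      rw [mul_inv_cancel₀ (by positivity), one_smul]
    · refine Finset.sum_congr rfl fun i _ => ?_
      congr 1; field_simp
  -- choose a vertex and a lattice shift
  obtain ⟨v, hv⟩ := (V.finite_toSet.isCompact_convexHull ℝ).extremePoints_nonempty ⟨p, hp⟩
  have htop : ((c : ℝ) - 1) • (v - p) ∈ Submodule.span ℝ (Set.range U) := by
    have hle : Submodule.span ℝ (Set.range e) ≤ Submodule.span ℝ (Set.range U) := by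
      rw [Submodule.span_le]
      rintro _ ⟨i, rfl⟩
      rw [heU]
      exact Submodule.smul_mem _ _ (Submodule.subset_span ⟨i, rfl⟩)
    rw [hespan] at hle
    exact hle Submodule.mem_top
  obtain ⟨lam, hlam⟩ := (Submodule.mem_span_range_iff_exists_fun ℝ).1 htop
  let θ : Fin d → ℝ := fun i => Int.fract (lam i)
  have hθ0 : ∀ i, 0 ≤ θ i := fun i => Int.fract_nonneg _
  have hθ1 : ∀ i, θ i ≤ 1 := fun i => (Int.fract_lt_one _).le
  have hc1 : (1 : ℝ) ≤ c - 1 := by linarith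
  refine ⟨v, hv, ((c : ℝ) - 1) • (p + ∑ i, (((c : ℝ) - 1)⁻¹ * θ i) • U i),
    smul_mem_smul_set (hbox _ ?_), ?_, p + ∑ i, (-θ i) • U i, hbox _ ?_, ?_⟩
  · intro i
    rw [abs_of_nonneg (mul_nonneg (by positivity) (hθ0 i))]
    exact mul_le_one₀ (inv_le_one_of_one_le₀ hc1) (hθ0 i) (hθ1 i)
  · have hx : ((c : ℝ) - 1) • (p + ∑ i, (((c : ℝ) - 1)⁻¹ * θ i) • U i) - ((c : ℝ) - 1) • v =
        ∑ i, (-(⌊lam i⌋ : ℝ)) • U i := by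
      have h1 : ((c : ℝ) - 1) • ∑ i, (((c : ℝ) - 1)⁻¹ * θ i) • U i = ∑ i, θ i • U i := by
        rw [Finset.smul_sum]
        refine Finset.sum_congr rfl fun i _ => ?_
        rw [smul_smul, ← mul_assoc, mul_inv_cancel₀ (by linarith), one_mul]
      rw [smul_add, h1]
      have h2 : ∑ i, (-(⌊lam i⌋ : ℝ)) • U i = ∑ i, θ i • U i - ∑ i, lam i • U i := by
        rw [← Finset.sum_sub_distrib]
        refine Finset.sum_congr rfl fun i _ => ?_
        rw [← sub_smul]
        congr 1
        simp only [θ, Int.fract]; ring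
      rw [h2, hlam]
      module
    rw [hx]
    intro j
    refine ⟨∑ i, -⌊lam i⌋ * u i j, ?_⟩
    simp [U]
  · intro i
    rw [abs_neg, abs_of_nonneg (hθ0 i)]
    exact hθ1 i
  · rw [smul_add, Finset.smul_sum]
    have h1 : ∑ i, ((c : ℝ) - 1) • (((c : ℝ) - 1)⁻¹ * θ i) • U i = ∑ i, θ i • U i := by
      refine Finset.sum_congr rfl fun i _ => ?_
      rw [smul_smul, ← mul_assoc, mul_inv_cancel₀ (by linarith), one_mul]
    rw [h1]
    simp only [neg_smul, Finset.sum_neg_distrib]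
    module

/-- Corollary 5.2(a). If every rational `(d-1)`-polytope with edges of lattice
length `≥ l` satisfies `CN(d-1, k + (k-1)/d)`, then every rational `d`-polytope with edges of
lattice length `> max(k·d·(d+1), (d+1)·l/d)` is `k`-convex-normal. -/
theorem statement14 (d : ℕ) (hd : 2 ≤ d) (k : ℚ) (hk : 2 ≤ k) (l : ℚ) (hl : 0 < l)
    (hyp : ∀ Q : Set (Pt d), IsRationalPolytope Q → polyDim Q = d - 1 →
      EdgeLengthsGE Q (l : ℝ) →
      ∀ c : ℚ, 2 ≤ c → c ≤ k + (k - 1) / (d : ℚ) → (c : ℝ) • Q = cnUnion Q (c : ℝ)) :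
    ∀ P : Set (Pt d), IsRationalPolytope P → polyDim P = d →
      EdgeLengthsGT P
        (max ((k : ℝ) * (d : ℝ) * ((d : ℝ) + 1)) (((d : ℝ) + 1) * (l : ℝ) / (d : ℝ))) →
      ConvexNormal k P := by
  rintro P ⟨V, hVrat, rfl⟩ hdim hedge
  have hdR : (2 : ℝ) ≤ d := by exact_mod_cast hd
  have hV : vectorSpan ℝ (V : Set (Pt d)) = ⊤ := by
    have h1 : vectorSpan ℝ (convexHull ℝ (V : Set (Pt d))) = vectorSpan ℝ (V : Set (Pt d)) := by
      rw [← direction_affineSpan, affineSpan_convexHull, direction_affineSpan]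
    rw [polyDim, h1] at hdim
    apply Submodule.eq_top_of_finrank_eq
    rw [hdim]; simp
  have hedge1 : EdgeLengthsGT (convexHull ℝ (V : Set (Pt d)))
      ((k : ℝ) * (d : ℝ) * ((d : ℝ) + 1)) := fun v w h u t ht hu hut =>
    lt_of_le_of_lt (le_max_left _ _) (hedge v w h u t ht hu hut)
  have hedge2 : EdgeLengthsGT (convexHull ℝ (V : Set (Pt d)))
      (((d : ℝ) + 1) * (l : ℝ) / (d : ℝ)) := fun v w h u t ht hu hut =>
    lt_of_le_of_lt (le_max_right _ _) (hedge v w h u t ht hu hut)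
  have hconv : Convex ℝ (convexHull ℝ (V : Set (Pt d))) := convex_convexHull ℝ _
  intro c hc2 hck
  have hcR : (2 : ℝ) ≤ c := by exact_mod_cast hc2
  apply Subset.antisymm
  · rintro _ ⟨p, hp, rfl⟩
    have hden : (0 : ℝ) < c * (d + 1) := by positivity
    have hden1 : (1 : ℝ) < c * (d + 1) := by nlinarith
    set s0 : ℝ := 1 / ((c : ℝ) * (d + 1)) with hs0
    have hs0pos : 0 < s0 := by positivity
    have hs0lt : s0 < 1 := by rw [hs0, div_lt_one hden]; exact hden1
    by_cases hall : ∀ w ∈ convexHull ℝ (V : Set (Pt d)),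
        p + (s0 / (1 - s0)) • (p - w) ∈ convexHull ℝ (V : Set (Pt d))
    · refine deep_step d hd k V hVrat hV hedge1 c hc2 hck p hp ?_
      intro a ha b hb
      have := hconv (hall b hb) ha (a := 1 - s0) (b := s0) (by linarith) hs0pos.le (by ring)
      convert this using 1
      rw [← hs0]
      have hne : (1 - s0) ≠ 0 := by linarith
      have h1 : (1 - s0) * (s0 / (1 - s0)) = s0 := by field_simp
      rw [smul_add, smul_smul, h1]
      module
    · push Not at hall
      obtain ⟨w, hw, hout⟩ := hall
      obtain ⟨f, hfseg, W, hWV, hfW, hext, hWdim⟩ := exit_facet V hV p _ hp hout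
      obtain ⟨α, β, hα, hβ, hαβ, hfe⟩ := hfseg
      have h1s : 0 < 1 - s0 := by linarith
      set σ := s0 / (1 - s0) with hσ
      have hσpos : 0 < σ := by positivity
      set r := β * σ with hr
      have hr0 : 0 ≤ r := by positivity
      have hrσ : r ≤ σ := by
        rw [hr]; nlinarith
      have hfr : f = (1 + r) • p - r • w := by
        rw [← hfe, hr, ← eq_sub_iff_add_eq.2 hαβ |>.symm]
        module
      have hpe : p = (1 - r / (1 + r)) • f + (r / (1 + r)) • w := by
        have h2 : 1 - r / (1 + r) = 1 / (1 + r) := by field_simp; ring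
        have h3 : 1 / (1 + r) * (1 + r) = 1 := by field_simp
        have h4 : 1 / (1 + r) * r = r / (1 + r) := by field_simp
        rw [hfr, h2, smul_sub, smul_smul, smul_smul, h3, h4, one_smul]
        abel
      have hs : r / (1 + r) * (c * ((d : ℝ) + 1)) ≤ 1 := by
        rw [← le_div_iff₀ hden, ← hs0, div_le_iff₀ (by linarith)]
        have : σ * (1 - s0) = s0 := by rw [hσ]; field_simp
        nlinarith
      have := pyramid_step d hd k l hyp V W hVrat hWV hedge2 hext hWdim c hc2 hck f w hfW hw
        (r / (1 + r)) (by positivity) hs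
      rw [← hpe] at this
      exact this
  · rintro y ⟨v, hv, x, hx, -, p, hp, rfl⟩
    have h := hconv.add_smul (p := (c : ℝ) - 1) (q := 1) (by linarith) (by norm_num)
    rw [sub_add_cancel, one_smul] at h
    rw [h]
    exact Set.add_mem_add hx hp
end
end

section
/- For every positive integer d and every k ∈ ℚ with k ≥ 2 there exists l ∈ ℚ such that every rational polytope P ⊂ ℝ^d of dimension d all of whose edges have lattice length at least l is k-convex-normal. -/
open Set Metric Pointwise

noncomputable section

section helpers

variable {E : Type*} [NormedAddCommGroup E] [NormedSpace ℝ E]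

lemma cn_sepLin {F : Type*} [NormedAddCommGroup F] [NormedSpace ℝ F] (X : Set F)
    (hX : Convex ℝ X) (hXc : IsCompact X) (h0 : (0 : F) ∈ X) (T : F →L[ℝ] E) (θ : F →L[ℝ] ℝ)
    (c : ℝ) (h : ∀ x ∈ X, T x = 0 → θ x < c) :
    ∃ g : E →L[ℝ] ℝ, ∀ x ∈ X, θ x + g (T x) < c := by
  have hc : 0 < c := by simpa using h 0 h0 (by simp)
  set Φ : F →L[ℝ] (E × ℝ) := T.prod θ with hΦ
  have hDc : IsCompact (Φ '' X) := hXc.image Φ.continuous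
  have hD : Convex ℝ (Φ '' X) := hX.linear_image Φ.toLinearMap
  have hnot : ((0 : E), c) ∉ Φ '' X := by
    rintro ⟨x, hx, hxe⟩
    have h1 : T x = 0 := congrArg Prod.fst hxe
    have h2 : θ x = c := congrArg Prod.snd hxe
    exact absurd (h x hx h1) (by rw [h2]; exact lt_irrefl _)
  obtain ⟨f, u, hf, hu⟩ := geometric_hahn_banach_closed_point hD hDc.isClosed hnot
  have hsplit : ∀ (e : E) (r : ℝ), f (e, r) = f (e, 0) + r * f (0, 1) := by
    intro e r
    have : ((e, r) : E × ℝ) = (e, 0) + r • ((0 : E), (1 : ℝ)) := by simp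
    rw [this, map_add, map_smul, smul_eq_mul]
  have hz : (0 : ℝ) < u := by
    have := hf (Φ 0) ⟨0, h0, rfl⟩
    simpa using this
  have hcu : u < c * f (0, 1) := by
    have := hu
    rw [hsplit] at this
    have h00 : f ((0 : E), (0 : ℝ)) = 0 := f.map_zero
    rw [h00] at this
    linarith
  have hτ : 0 < f (0, 1) := by
    by_contra hn
    push Not at hn
    nlinarith
  refine ⟨(f (0, 1))⁻¹ • f.comp (ContinuousLinearMap.inl ℝ E ℝ), fun x hx => ?_⟩
  have h1 := hf (Φ x) ⟨x, hx, rfl⟩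
  have h2 : f (Φ x) = f (T x, 0) + θ x * f (0, 1) := hsplit (T x) (θ x)
  rw [h2] at h1
  have h3 : ((f (0, 1))⁻¹ • f.comp (ContinuousLinearMap.inl ℝ E ℝ)) (T x)
      = (f (0, 1))⁻¹ * f (T x, 0) := by simp
  rw [h3]
  have h4 : θ x + (f (0, 1))⁻¹ * f (T x, 0) = (f (T x, 0) + θ x * f (0, 1)) / f (0, 1) := by
    field_simp; ring
  rw [h4, div_lt_iff₀ hτ]
  linarith

/-- `φ` is integral on `Λ`. -/
def CnIntOn (Λ : AddSubgroup E) (φ : E →L[ℝ] ℝ) : Prop := ∀ x ∈ Λ, ∃ n : ℤ, φ x = n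

/-- enough integral functionals -/
def CnSep (Λ : AddSubgroup E) : Prop :=
  ∀ x ∈ Λ, x ≠ 0 → ∃ φ : E →L[ℝ] ℝ, CnIntOn Λ φ ∧ φ x ≠ 0

/-- the kernel sublattice -/
def cnKer (Λ : AddSubgroup E) (φ : E →L[ℝ] ℝ) : AddSubgroup E where
  carrier := {x | x ∈ Λ ∧ φ x = 0}
  zero_mem' := ⟨Λ.zero_mem, by simp⟩
  add_mem' := fun {a b} ha hb => ⟨Λ.add_mem ha.1 hb.1, by rw [map_add, ha.2, hb.2, add_zero]⟩
  neg_mem' := fun {a} ha => ⟨Λ.neg_mem ha.1, by rw [map_neg, ha.2, neg_zero]⟩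

lemma mem_cnKer {Λ : AddSubgroup E} {φ : E →L[ℝ] ℝ} {x : E} :
    x ∈ cnKer Λ φ ↔ x ∈ Λ ∧ φ x = 0 := Iff.rfl

lemma cnSep_ker {Λ : AddSubgroup E} (h : CnSep Λ) (φ : E →L[ℝ] ℝ) : CnSep (cnKer Λ φ) := by
  intro x hx hx0
  obtain ⟨χ, hχ, hχx⟩ := h x hx.1 hx0
  exact ⟨χ, fun y hy => hχ y hy.1, hχx⟩

lemma cn_span_ker {Λ : AddSubgroup E} {φ : E →L[ℝ] ℝ} (hφ : CnIntOn Λ φ) {l0 : E}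
    (hl0 : l0 ∈ Λ) (hl0' : φ l0 ≠ 0) {x : E} (hx : x ∈ Submodule.span ℝ (Λ : Set E))
    (hx0 : φ x = 0) : x ∈ Submodule.span ℝ (cnKer Λ φ : Set E) := by
  have key : ∀ y ∈ Submodule.span ℝ (Λ : Set E),
      φ l0 • y - φ y • l0 ∈ Submodule.span ℝ (cnKer Λ φ : Set E) := by
    intro y hy
    induction hy using Submodule.span_induction with
    | mem y hy =>
      apply Submodule.subset_span
      obtain ⟨a, ha⟩ := hφ l0 hl0
      obtain ⟨b, hb⟩ := hφ y hy
      refine ⟨?_, ?_⟩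
      · rw [ha, hb, Int.cast_smul_eq_zsmul, Int.cast_smul_eq_zsmul]
        exact Λ.sub_mem (Λ.zsmul_mem hy a) (Λ.zsmul_mem hl0 b)
      · simp [mul_comm]
    | zero => simp
    | add y z _ _ hy hz =>
      have : φ l0 • (y + z) - φ (y + z) • l0
          = (φ l0 • y - φ y • l0) + (φ l0 • z - φ z • l0) := by
        rw [map_add]; module
      rw [this]; exact Submodule.add_mem _ hy hz
    | smul a y _ hy =>
      have : φ l0 • (a • y) - φ (a • y) • l0 = a • (φ l0 • y - φ y • l0) := by
        rw [map_smul, smul_eq_mul]; module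
      rw [this]; exact Submodule.smul_mem _ _ hy
  have h1 := key x hx
  rw [hx0, zero_smul, sub_zero] at h1
  exact (Submodule.smul_mem_iff _ hl0').1 h1

lemma cn_finrank_ker [FiniteDimensional ℝ E] {Λ : AddSubgroup E} {φ : E →L[ℝ] ℝ} {l0 : E}
    (hl0 : l0 ∈ Λ) (hl0' : φ l0 ≠ 0) {n : ℕ}
    (hn : Module.finrank ℝ (Submodule.span ℝ (Λ : Set E)) ≤ n + 1) :
    Module.finrank ℝ (Submodule.span ℝ (cnKer Λ φ : Set E)) ≤ n := by
  have hle : Submodule.span ℝ (cnKer Λ φ : Set E) ≤ Submodule.span ℝ (Λ : Set E) :=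
    Submodule.span_mono (fun x hx => hx.1)
  have hk : Submodule.span ℝ (cnKer Λ φ : Set E) ≤ LinearMap.ker φ.toLinearMap :=
    Submodule.span_le.2 (fun x hx => hx.2)
  have hlt : Submodule.span ℝ (cnKer Λ φ : Set E) < Submodule.span ℝ (Λ : Set E) := by
    refine lt_of_le_of_ne hle (fun he => hl0' ?_)
    have : l0 ∈ Submodule.span ℝ (cnKer Λ φ : Set E) := by
      rw [he]; exact Submodule.subset_span hl0
    exact hk this
  have := Submodule.finrank_lt_finrank_of_lt hlt
  omega

/-- Almost shortest dual vector. -/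
lemma cn_short {Λ : AddSubgroup E} {M : Set E} (hMc : IsCompact M) (h0 : (0 : E) ∈ M) {c : ℝ}
    (hc : 0 < c)
    (H : ∀ φ, CnIntOn Λ φ → (∃ x ∈ Λ, φ x ≠ 0) → ∃ m ∈ M, c ≤ φ m)
    (hex : ∃ φ, CnIntOn Λ φ ∧ ∃ x ∈ Λ, φ x ≠ 0) :
    ∃ (φ : E →L[ℝ] ℝ) (N : ℝ), CnIntOn Λ φ ∧ (∃ x ∈ Λ, φ x ≠ 0) ∧ c ≤ N ∧
      (∃ m ∈ M, φ m = N) ∧ (∀ m ∈ M, φ m ≤ N) ∧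
      ∀ χ, CnIntOn Λ χ → (∃ x ∈ Λ, χ x ≠ 0) → ∃ m ∈ M, 2 / 3 * N ≤ χ m := by
  have hmax : ∀ φ : E →L[ℝ] ℝ, ∃ m ∈ M, ∀ m' ∈ M, φ m' ≤ φ m := fun φ =>
    hMc.exists_isMaxOn ⟨0, h0⟩ φ.continuous.continuousOn
  choose mx hmx hmx' using hmax
  set X : Set ℝ := {r | ∃ φ : E →L[ℝ] ℝ, CnIntOn Λ φ ∧ (∃ x ∈ Λ, φ x ≠ 0) ∧ r = φ (mx φ)}
  have hXc : ∀ r ∈ X, c ≤ r := by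
    rintro r ⟨φ, h1, h2, rfl⟩
    obtain ⟨m, hm, hm'⟩ := H φ h1 h2
    exact hm'.trans (hmx' φ m hm)
  have hXne : X.Nonempty := by
    obtain ⟨φ, h1, h2⟩ := hex
    exact ⟨_, φ, h1, h2, rfl⟩
  have hI : c ≤ sInf X := le_csInf hXne hXc
  obtain ⟨r, ⟨φ, h1, h2, rfl⟩, hr⟩ := exists_lt_of_csInf_lt hXne
    (show sInf X < 3 / 2 * sInf X by linarith)
  refine ⟨φ, φ (mx φ), h1, h2, hXc _ ⟨φ, h1, h2, rfl⟩, ⟨_, hmx φ, rfl⟩, hmx' φ, ?_⟩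
  intro χ hχ1 hχ2
  refine ⟨mx χ, hmx χ, ?_⟩
  have : sInf X ≤ χ (mx χ) := csInf_le ⟨c, hXc⟩ ⟨χ, hχ1, hχ2, rfl⟩
  linarith

lemma cn_prim {Λ : AddSubgroup E} {M : Set E} {φ : E →L[ℝ] ℝ} {N : ℝ} (hN : 0 < N)
    (hφ : CnIntOn Λ φ) (hne : ∃ x ∈ Λ, φ x ≠ 0) (hle : ∀ m ∈ M, φ m ≤ N)
    (hχ : ∀ χ, CnIntOn Λ χ → (∃ x ∈ Λ, χ x ≠ 0) → ∃ m ∈ M, 2 / 3 * N ≤ χ m) :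
    ∃ x ∈ Λ, φ x = 1 := by
  let H : AddSubgroup ℤ :=
    { carrier := {k | ∃ x ∈ Λ, φ x = k}
      zero_mem' := ⟨0, Λ.zero_mem, by simp⟩
      add_mem' := by
        rintro a b ⟨x, hx, hxa⟩ ⟨y, hy, hyb⟩
        exact ⟨x + y, Λ.add_mem hx hy, by simp [hxa, hyb]⟩
      neg_mem' := by
        rintro a ⟨x, hx, hxa⟩
        exact ⟨-x, Λ.neg_mem hx, by simp [hxa]⟩ }
  obtain ⟨g, hg⟩ := Int.subgroup_cyclic H
  have hgm : ∀ k : ℤ, k ∈ H ↔ ∃ j : ℤ, j * g = k := by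
    intro k
    rw [hg, AddSubgroup.mem_closure_singleton]
    simp
  wlog hpos : 0 ≤ g generalizing g
  · refine this (-g) ?_ ?_ (by omega)
    · rw [hg, ← AddSubgroup.zmultiples_eq_closure, ← AddSubgroup.zmultiples_eq_closure,
        AddSubgroup.zmultiples_neg]
    · intro k
      rw [hgm]
      constructor
      · rintro ⟨j, hj⟩; exact ⟨-j, by linarith⟩
      · rintro ⟨j, hj⟩; exact ⟨-j, by linarith⟩
  have hg0 : g ≠ 0 := by
    rintro rfl
    obtain ⟨x, hx, hx0⟩ := hne
    obtain ⟨k, hk⟩ := hφ x hx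
    obtain ⟨j, hj⟩ := (hgm k).1 ⟨x, hx, hk⟩
    apply hx0
    rw [hk, ← hj]; simp
  have hgp : 0 < g := lt_of_le_of_ne hpos (Ne.symm hg0)
  have hgr : (0 : ℝ) < g := by exact_mod_cast hgp
  obtain ⟨m, hm, hm'⟩ := hχ ((g : ℝ)⁻¹ • φ) (by
    intro x hx
    obtain ⟨k, hk⟩ := hφ x hx
    obtain ⟨j, hj⟩ := (hgm k).1 ⟨x, hx, hk⟩
    refine ⟨j, ?_⟩
    simp only [ContinuousLinearMap.smul_apply, smul_eq_mul]
    rw [hk, ← hj]; push_cast; field_simp) (by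
    obtain ⟨x, hx, hx0⟩ := hne
    exact ⟨x, hx, by simp [hx0, hg0]⟩)
  have h1 := hle m hm
  simp only [ContinuousLinearMap.smul_apply, smul_eq_mul] at hm'
  rw [← div_eq_inv_mul, le_div_iff₀ hgr] at hm'
  have hg1 : g = 1 := by
    by_contra hne1
    have : (2 : ℝ) ≤ g := by exact_mod_cast (show (2 : ℤ) ≤ g by omega)
    nlinarith
  obtain ⟨x, hx, hx1⟩ := (hgm 1).2 ⟨1, by rw [hg1]; rfl⟩
  exact ⟨x, hx, by rw [hx1]; simp⟩

theorem cn_flat [FiniteDimensional ℝ E] (n : ℕ) : ∀ (Λ : AddSubgroup E), CnSep Λ →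
    Module.finrank ℝ (Submodule.span ℝ (Λ : Set E)) ≤ n →
    ∀ M : Set E, IsCompact M → Convex ℝ M → (∀ m ∈ M, -m ∈ M) → (0 : E) ∈ M →
    M ⊆ Submodule.span ℝ (Λ : Set E) →
    (∀ φ, CnIntOn Λ φ → (∃ x ∈ Λ, φ x ≠ 0) → ∃ m ∈ M, (16 : ℝ) ^ n ≤ φ m) →
    ∀ a ∈ Submodule.span ℝ (Λ : Set E), ∃ m ∈ M, m - a ∈ Λ := by
  induction n with
  | zero =>
    intro Λ _ hn M _ _ _ h0 _ _ a ha
    have hb : Submodule.span ℝ (Λ : Set E) = ⊥ := Submodule.finrank_eq_zero.1 (by omega)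
    rw [hb, Submodule.mem_bot] at ha
    subst ha
    exact ⟨0, h0, by simp [Λ.zero_mem]⟩
  | succ n ih =>
    intro Λ hS hn M hMc hMx hMs h0 hMW H a ha
    by_cases hex : ∃ φ, CnIntOn Λ φ ∧ ∃ x ∈ Λ, φ x ≠ 0
    swap
    · have hΛ : ∀ x ∈ Λ, x = 0 := by
        intro x hx
        by_contra hx0
        obtain ⟨φ, h1, h2⟩ := hS x hx hx0
        exact hex ⟨φ, h1, x, hx, h2⟩
      have hb : Submodule.span ℝ (Λ : Set E) = ⊥ := by
        rw [Submodule.span_eq_bot]; exact hΛ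
      rw [hb, Submodule.mem_bot] at ha
      subst ha
      exact ⟨0, h0, by simp [Λ.zero_mem]⟩
    obtain ⟨φ, N, hφ, hne, hcN, ⟨m1, hm1, hm1N⟩, hle, hχ⟩ :=
      cn_short hMc h0 (by positivity) H hex
    have hp : (0 : ℝ) < 16 ^ n := by positivity
    have hp1 : (1 : ℝ) ≤ 16 ^ n := one_le_pow₀ (by norm_num)
    rw [pow_succ] at hcN
    have hN : 0 < N := by linarith
    obtain ⟨l0, hl0, hl01⟩ := cn_prim hN hφ hne hle hχ
    have hl0' : φ l0 ≠ 0 := by rw [hl01]; norm_num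
    set M' : Set E := {m | φ m = 0 ∧ (2 : ℝ) • m ∈ M} with hM'
    have hM'c : IsCompact M' := by
      have : M' = (fun m : E => (2 : ℝ)⁻¹ • m) '' (M ∩ {m | φ m = 0}) := by
        ext m
        constructor
        · rintro ⟨h1, h2⟩
          exact ⟨(2 : ℝ) • m, ⟨h2, by simp [h1]⟩, by simp [smul_smul]⟩
        · rintro ⟨m, ⟨h1, h2⟩, rfl⟩
          refine ⟨?_, ?_⟩
          · have : φ m = 0 := h2
            simp [this]
          · simpa [smul_smul] using h1
      rw [this]
      refine IsCompact.image ?_ (by fun_prop)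
      exact hMc.inter_right (isClosed_eq φ.continuous continuous_const)
    have hM'x : Convex ℝ M' := by
      intro x hx y hy s t hs ht hst
      refine ⟨by simp [hx.1, hy.1], ?_⟩
      have : (2 : ℝ) • (s • x + t • y) = s • ((2 : ℝ) • x) + t • ((2 : ℝ) • y) := by module
      rw [this]
      exact hMx hx.2 hy.2 hs ht hst
    have ih' := ih (cnKer Λ φ) (cnSep_ker hS φ) (cn_finrank_ker hl0 hl0' hn) M' hM'c hM'x
      (fun m hm => ⟨by simp [hm.1], by rw [smul_neg]; exact hMs _ hm.2⟩)
      ⟨by simp, by simpa using h0⟩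
      (by
        intro m hm
        refine cn_span_ker hφ hl0 hl0' ?_ hm.1
        have := hMW hm.2
        exact (Submodule.smul_mem_iff _ (by norm_num)).1 this)
      (by
        intro χ' hχ' hne'
        by_contra hcon
        push Not at hcon
        set χ : E →L[ℝ] ℝ := χ' - χ' l0 • φ with hχdef
        have hχker : ∀ x, φ x = 0 → χ x = χ' x := by
          intro x hx; simp [hχdef, hx]
        have hχint : CnIntOn Λ χ := by
          intro x hx
          obtain ⟨k, hk⟩ := hφ x hx
          obtain ⟨j, hj⟩ := hχ' (x - k • l0)
            ⟨Λ.sub_mem hx (Λ.zsmul_mem hl0 k), by simp [hk, hl01]⟩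
          refine ⟨j, ?_⟩
          rw [← hj]
          simp [hχdef, hk, mul_comm]
        obtain ⟨s, hs⟩ : ∃ s : ℝ, ∀ m ∈ M, χ m + s * φ m < 2 * 16 ^ n := by
          obtain ⟨g, hg⟩ := cn_sepLin M hMx hMc h0 φ χ (2 * 16 ^ n) (by
            intro m hm hm0
            rw [hχker m hm0]
            have := hcon ((2 : ℝ)⁻¹ • m) ⟨by simp [hm0], by simpa [smul_smul] using hm⟩
            rw [map_smul, smul_eq_mul] at this
            linarith)
          refine ⟨g 1, fun m hm => ?_⟩
          have h1 := hg m hm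
          have h2 : g (φ m) = g 1 * φ m := by
            conv_lhs => rw [show φ m = φ m • (1 : ℝ) by simp]
            rw [map_smul, smul_eq_mul, mul_comm]
          linarith
        obtain ⟨m, hm, hmge⟩ := hχ (χ + (round s : ℝ) • φ) (by
          intro x hx
          obtain ⟨k, hk⟩ := hφ x hx
          obtain ⟨j, hj⟩ := hχint x hx
          exact ⟨j + round s * k, by simp [hk, hj]⟩) (by
          obtain ⟨x, hx, hx0⟩ := hne'
          refine ⟨x, hx.1, ?_⟩
          simp only [ContinuousLinearMap.add_apply, ContinuousLinearMap.smul_apply, hx.2,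
            smul_zero, add_zero]
          rwa [hχker x hx.2])
        simp only [ContinuousLinearMap.add_apply, ContinuousLinearMap.smul_apply,
            smul_eq_mul] at hmge
        have h1 := hs m hm
        have h2 := abs_le.1 (abs_sub_round s)
        have h3 := hle m hm
        have h4 := hle _ (hMs m hm)
        rw [map_neg] at h4
        have h5 : |(s - round s) * φ m| ≤ 1 / 2 * N := by
          rw [abs_mul]
          exact mul_le_mul (abs_sub_round s) (abs_le.2 ⟨by linarith, h3⟩) (abs_nonneg _)
            (by norm_num)
        have h6 := (abs_le.1 h5).1
        nlinarith)
    set j : ℤ := round (φ a) with hj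
    have hjr := abs_sub_round (φ a)
    set r : ℝ := φ a - j with hr
    set s : ℝ := r / N with hs
    have hsb : |s| ≤ 1 / 2 := by
      rw [hs, abs_div, abs_of_pos hN, div_le_iff₀ hN]
      have : |r| ≤ 1 / 2 := hjr
      nlinarith
    have hsN : s * N = r := by rw [hs]; field_simp
    obtain ⟨m, hm, hmΛ⟩ := ih' (a - j • l0 - s • m1) (by
      refine cn_span_ker hφ hl0 hl0' ?_ ?_
      · refine Submodule.sub_mem _ (Submodule.sub_mem _ ha ?_) ?_
        · exact Submodule.subset_span (Λ.zsmul_mem hl0 j)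
        · exact Submodule.smul_mem _ _ (hMW hm1)
      · simp only [map_sub, map_smul, map_zsmul, hl01, hm1N, smul_eq_mul, hsN, hr]
        simp)
    refine ⟨m + s • m1, ?_, ?_⟩
    · have h2s := abs_le.1 hsb
      have h2 : (2 * s) • m1 ∈ M := by
        have : (2 * s) • m1 = ((1 + 2 * s) / 2) • m1 + ((1 - 2 * s) / 2) • (-m1) := by module
        rw [this]
        exact hMx hm1 (hMs _ hm1) (by linarith) (by linarith) (by ring)
      have : m + s • m1 = (1 / 2 : ℝ) • ((2 : ℝ) • m) + (1 / 2 : ℝ) • ((2 * s) • m1) := by module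
      rw [this]
      exact hMx hm.2 h2 (by norm_num) (by norm_num) (by norm_num)
    · have h1 := Λ.sub_mem hmΛ.1 (Λ.zsmul_mem hl0 j)
      have : m + s • m1 - a = m - (a - j • l0 - s • m1) - j • l0 := by abel
      rw [this]; exact h1

open scoped NNReal in
lemma cn_mem_cone {S : Set E} {x : E} (hx : x ∈ Submodule.span ℝ≥0 S) :
    ∃ (s : Finset E) (a : E → ℝ), (∀ u ∈ s, u ∈ S) ∧ (∀ u, 0 ≤ a u) ∧ x = ∑ u ∈ s, a u • u := by
  obtain ⟨s, hs, hxs⟩ := Submodule.mem_span_finite_of_mem_span hx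
  obtain ⟨f, -, hf⟩ := Submodule.mem_span_finset.1 hxs
  exact ⟨s, fun u => (f u : ℝ), fun u hu => hs hu, fun u => (f u).2, hf.symm⟩

open scoped NNReal in
lemma cn_cone_smul (C : Submodule ℝ≥0 E) {r : ℝ} (hr : 0 ≤ r) {x : E} (hx : x ∈ C) :
    r • x ∈ C := C.smul_mem ⟨r, hr⟩ hx

lemma cn_sum3 {A : Type*} [AddCommMonoid A] (s : Finset E) (φ : E → ℝ) (F : E → A) :
    ∑ u ∈ s, F u = ∑ u ∈ s.filter (fun u => φ u = 0), F u
      + (∑ u ∈ s.filter (fun u => 0 < φ u), F u + ∑ u ∈ s.filter (fun u => φ u < 0), F u) := by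
  classical
  rw [← Finset.sum_filter_add_sum_filter_not s (fun u => φ u = 0)]
  congr 1
  rw [← Finset.sum_filter_add_sum_filter_not (s.filter (fun u => ¬ φ u = 0))
    (fun u => 0 < φ u), Finset.filter_filter, Finset.filter_filter]
  congr 1
  · apply Finset.sum_congr _ (fun _ _ => rfl)
    ext u; simp only [Finset.mem_filter]
    constructor
    · rintro ⟨h1, h2, h3⟩; exact ⟨h1, h3⟩
    · rintro ⟨h1, h3⟩; exact ⟨h1, h3.ne', h3⟩
  · apply Finset.sum_congr _ (fun _ _ => rfl)
    ext u; simp only [Finset.mem_filter]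
    constructor
    · rintro ⟨h1, h2, h3⟩; exact ⟨h1, lt_of_le_of_ne (not_lt.1 h3) h2⟩
    · rintro ⟨h1, h3⟩; exact ⟨h1, h3.ne, not_lt.2 h3.le⟩

open scoped NNReal in
lemma cn_slice {S : Set E} (C : Submodule ℝ≥0 E) (φ : E →L[ℝ] ℝ)
    (h0 : ∀ e ∈ S, φ e = 0 → e ∈ C)
    (h2 : ∀ e ∈ S, ∀ f ∈ S, 0 < φ e → φ f < 0 → (-φ f) • e + φ e • f ∈ C)
    {x : E} (hx : x ∈ Submodule.span ℝ≥0 S) (hx0 : φ x = 0) : x ∈ C := by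
  classical
  obtain ⟨s, a, hs, ha, rfl⟩ := cn_mem_cone hx
  set sp := s.filter (fun u => 0 < φ u) with hsp
  set sn := s.filter (fun u => φ u < 0) with hsn
  set sz := s.filter (fun u => φ u = 0) with hsz
  have hz : ∑ u ∈ sz, a u • u ∈ C := by
    refine C.sum_mem (fun u hu => cn_cone_smul C (ha u) ?_)
    rw [hsz, Finset.mem_filter] at hu
    exact h0 u (hs u hu.1) hu.2
  set Q : ℝ := ∑ u ∈ sp, a u * φ u with hQ
  have hQn : ∑ u ∈ sn, a u * (-φ u) = Q := by
    have h1 : φ (∑ u ∈ s, a u • u) = ∑ u ∈ s, a u * φ u := by simp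
    rw [h1, cn_sum3 s φ (fun u => a u * φ u)] at hx0
    have h3 : ∑ u ∈ sz, a u * φ u = 0 := by
      apply Finset.sum_eq_zero
      intro u hu
      rw [hsz, Finset.mem_filter] at hu
      rw [hu.2, mul_zero]
    have h4 : ∑ u ∈ sn, a u * (-φ u) = - ∑ u ∈ sn, a u * φ u := by
      rw [← Finset.sum_neg_distrib]; simp
    rw [h4]; linarith
  have hpp : ∀ u ∈ sp, 0 ≤ a u * φ u := by
    intro u hu
    rw [hsp, Finset.mem_filter] at hu
    exact mul_nonneg (ha u) hu.2.le
  have hnn : ∀ u ∈ sn, 0 ≤ a u * (-φ u) := by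
    intro u hu
    rw [hsn, Finset.mem_filter] at hu
    exact mul_nonneg (ha u) (by linarith [hu.2])
  have hQ0 : 0 ≤ Q := Finset.sum_nonneg hpp
  rw [cn_sum3 s φ (fun u => a u • u)]
  refine C.add_mem hz ?_
  rcases hQ0.eq_or_lt with hQe | hQp
  · have e1 : ∑ u ∈ sp, a u • u = 0 := by
      apply Finset.sum_eq_zero
      intro u hu
      have := (Finset.sum_eq_zero_iff_of_nonneg hpp).1 hQe.symm u hu
      rw [hsp, Finset.mem_filter] at hu
      rcases mul_eq_zero.1 this with h | h
      · rw [h, zero_smul]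
      · exact absurd h hu.2.ne'
    have e2 : ∑ u ∈ sn, a u • u = 0 := by
      apply Finset.sum_eq_zero
      intro u hu
      have := (Finset.sum_eq_zero_iff_of_nonneg hnn).1 (hQn.trans hQe.symm) u hu
      rw [hsn, Finset.mem_filter] at hu
      rcases mul_eq_zero.1 this with h | h
      · rw [h, zero_smul]
      · exact absurd h (by linarith [hu.2])
    rw [e1, e2, add_zero]; exact C.zero_mem
  · have key : ∑ i ∈ sp, ∑ j ∈ sn, (a i * a j) • ((-φ j) • i + φ i • j)
        = Q • (∑ u ∈ sp, a u • u + ∑ u ∈ sn, a u • u) := by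
      have k1 : ∀ i ∈ sp, ∑ j ∈ sn, (a i * a j) • ((-φ j) • i + φ i • j)
          = Q • (a i • i) + (a i * φ i) • ∑ j ∈ sn, a j • j := by
        intro i _
        rw [← hQn, Finset.sum_smul, Finset.smul_sum, ← Finset.sum_add_distrib]
        apply Finset.sum_congr rfl
        intro j _
        module
      rw [Finset.sum_congr rfl k1, Finset.sum_add_distrib, ← Finset.sum_smul, smul_add,
        ← Finset.smul_sum]
    have hmem : Q • (∑ u ∈ sp, a u • u + ∑ u ∈ sn, a u • u) ∈ C := by
      rw [← key]
      refine C.sum_mem (fun i hi => C.sum_mem (fun j hj => ?_))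
      rw [hsp, Finset.mem_filter] at hi
      rw [hsn, Finset.mem_filter] at hj
      exact cn_cone_smul C (mul_nonneg (ha i) (ha j)) (h2 i (hs i hi.1) j (hs j hj.1) hi.2 hj.2)
    have := cn_cone_smul C (inv_nonneg.2 hQ0) hmem
    rwa [smul_smul, inv_mul_cancel₀ hQp.ne', one_smul] at this

/-- admissible local directions at `v` -/
def cnGood (Λ : AddSubgroup E) (P : Set E) (V : Finset E) (χ : E →L[ℝ] ℝ) (k R l : ℝ) (v : E) :
    Set E :=
  {e | v + e ∈ P ∧ (R ≤ χ (v + e) + k ∨ (v + e ∈ V ∧ ∃ y ∈ Λ, ∃ t : ℝ, l ≤ t ∧ e = t • y))}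

lemma cn_decomp {V : Finset E} {χ : E →L[ℝ] ℝ} {k R : ℝ} (hR : 1 ≤ R)
    (hpos : ∀ v ∈ V, 0 ≤ χ v + k) {q : E} (hq : q ∈ convexHull ℝ (V : Set E))
    (hq1 : χ q + k ≤ 1 / 2) :
    ∃ (t : ℝ) (f g : E), 0 ≤ t ∧ t * R ≤ 1 / 2 ∧
      f ∈ convexHull ℝ ((V.filter (fun v => χ v + k < R) : Finset E) : Set E) ∧
      g ∈ convexHull ℝ (V : Set E) ∧ q = (1 - t) • f + t • g ∧ χ f + k ≤ 1 := by
  classical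
  obtain ⟨w, hw0, hw1, hwq⟩ := Finset.mem_convexHull'.1 hq
  set L := V.filter (fun v => χ v + k < R) with hL
  set Hh := V.filter (fun v => ¬ (χ v + k < R)) with hH
  have hsum : ∀ (F : E → ℝ),
      ∑ u ∈ V, F u = ∑ u ∈ L, F u + ∑ u ∈ Hh, F u := fun F =>
    (Finset.sum_filter_add_sum_filter_not V _ F).symm
  have hwL : ∀ u ∈ L, 0 ≤ w u := fun u hu => hw0 u (Finset.mem_filter.1 hu).1
  have hwH : ∀ u ∈ Hh, 0 ≤ w u := fun u hu => hw0 u (Finset.mem_filter.1 hu).1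
  set t := ∑ u ∈ Hh, w u with ht
  have ht0 : 0 ≤ t := Finset.sum_nonneg hwH
  have hLt : ∑ u ∈ L, w u = 1 - t := by
    have := hsum w
    linarith
  have hψ : χ q + k = ∑ u ∈ L, w u * (χ u + k) + ∑ u ∈ Hh, w u * (χ u + k) := by
    rw [← hsum (fun u => w u * (χ u + k))]
    simp only [mul_add, Finset.sum_add_distrib, ← Finset.sum_mul, hw1, one_mul]
    rw [← hwq]; simp
  have hLn : 0 ≤ ∑ u ∈ L, w u * (χ u + k) := Finset.sum_nonneg (fun u hu =>
    mul_nonneg (hwL u hu) (hpos u (Finset.mem_filter.1 hu).1))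
  have hHn : t * R ≤ ∑ u ∈ Hh, w u * (χ u + k) := by
    rw [ht, Finset.sum_mul]
    exact Finset.sum_le_sum (fun u hu => mul_le_mul_of_nonneg_left
      (not_lt.1 (Finset.mem_filter.1 hu).2) (hwH u hu))
  have htR : t * R ≤ 1 / 2 := by linarith
  have ht2 : t ≤ 1 / 2 := by nlinarith
  have h1t : 0 < 1 - t := by linarith
  set f := (1 - t)⁻¹ • ∑ u ∈ L, w u • u with hf
  have hff : (1 - t) • f = ∑ u ∈ L, w u • u := by
    rw [hf, smul_smul, mul_inv_cancel₀ h1t.ne', one_smul]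
  have hfm : f ∈ convexHull ℝ (L : Set E) := by
    refine Finset.mem_convexHull'.2 ⟨fun u => (1 - t)⁻¹ * w u, fun u hu =>
      mul_nonneg (inv_nonneg.2 h1t.le) (hwL u hu), ?_, ?_⟩
    · rw [← Finset.mul_sum, hLt, inv_mul_cancel₀ h1t.ne']
    · rw [hf, Finset.smul_sum]
      exact Finset.sum_congr rfl (fun u _ => by rw [smul_smul])
  have hfψ : χ f + k ≤ 1 := by
    have h1 : (1 - t) * (χ f + k) = ∑ u ∈ L, w u * (χ u + k) := by
      have : (1 - t) * χ f = χ ((1 - t) • f) := by simp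
      rw [mul_add, this, hff]
      simp only [mul_add, Finset.sum_add_distrib, ← Finset.sum_mul, hLt]
      simp
    have h2 : (1 - t) * (χ f + k) ≤ 1 / 2 := by rw [h1]; nlinarith
    by_contra hcon
    push Not at hcon
    nlinarith
  have hqs : q = (1 - t) • f + ∑ u ∈ Hh, w u • u := by
    rw [hff, ← hwq]
    exact (Finset.sum_filter_add_sum_filter_not V _ _).symm
  rcases ht0.eq_or_lt with he | hp
  · refine ⟨t, f, q, ht0, htR, hfm, hq, ?_, hfψ⟩
    have : ∑ u ∈ Hh, w u • u = 0 := by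
      apply Finset.sum_eq_zero
      intro u hu
      rw [(Finset.sum_eq_zero_iff_of_nonneg hwH).1 he.symm u hu, zero_smul]
    rw [this] at hqs
    conv_lhs => rw [hqs]
    rw [← he]; simp
  · refine ⟨t, f, t⁻¹ • ∑ u ∈ Hh, w u • u, ht0, htR, hfm, ?_, ?_, hfψ⟩
    · have : t⁻¹ • ∑ u ∈ Hh, w u • u ∈ convexHull ℝ (Hh : Set E) := by
        refine Finset.mem_convexHull'.2 ⟨fun u => t⁻¹ * w u, fun u hu =>
          mul_nonneg (inv_nonneg.2 ht0) (hwH u hu), ?_, ?_⟩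
        · rw [← Finset.mul_sum, ← ht, inv_mul_cancel₀ hp.ne']
        · rw [Finset.smul_sum]
          exact Finset.sum_congr rfl (fun u _ => by rw [smul_smul])
      refine convexHull_mono ?_ this
      exact_mod_cast Finset.filter_subset _ V
    · rw [smul_smul t t⁻¹, mul_inv_cancel₀ hp.ne', one_smul]; exact hqs

open scoped NNReal in
lemma cn_conn {G : E → Set E} {V' : Finset E} {χ φ : E →L[ℝ] ℝ} {k R : ℝ}
    (hlow : ∀ v ∈ V', χ v + k < R)
    (hG : ∀ v ∈ V', ∀ e ∈ G v, χ (v + e) + k < R → φ e = 0 ∧ v + e ∈ V')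
    (hcone : ∀ v ∈ V', ∀ w ∈ V', w - v ∈ Submodule.span ℝ≥0 (G v))
    {v0 : E} (hv0 : v0 ∈ V') (hmin : ∀ w ∈ V', χ v0 ≤ χ w) :
    ∀ w ∈ V', φ w = φ v0 := by
  classical
  by_contra hcon
  push Not at hcon
  obtain ⟨w1, hw1, hw1'⟩ := hcon
  obtain ⟨w, hw, hwmin⟩ := Finset.exists_min_image (V'.filter (fun w => φ w ≠ φ v0)) (fun w => χ w)
    ⟨w1, Finset.mem_filter.2 ⟨hw1, hw1'⟩⟩
  obtain ⟨hwV, hwne⟩ := Finset.mem_filter.1 hw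
  obtain ⟨s, a, hs, ha, hsum⟩ := cn_mem_cone (hcone w hwV v0 hv0)
  have hnn : ∀ u ∈ s, 0 ≤ a u * χ u := by
    intro u hu
    by_contra hn
    push Not at hn
    have hχu : χ u < 0 := by
      by_contra h; push Not at h
      exact absurd (mul_nonneg (ha u) h) (not_le.2 hn)
    have hlt : χ (w + u) + k < R := by
      rw [map_add]; linarith [hlow w hwV]
    obtain ⟨h1, h2⟩ := hG w hwV u (hs u hu) hlt
    have := hwmin (w + u) (Finset.mem_filter.2 ⟨h2, by rw [map_add, h1, add_zero]; exact hwne⟩)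
    simp only [map_add] at this
    linarith
  have h1 : ∑ u ∈ s, a u * χ u = χ v0 - χ w := by
    rw [← map_sub, hsum]; simp
  have h2 : ∑ u ∈ s, a u * χ u = 0 :=
    le_antisymm (by rw [h1]; linarith [hmin w hwV]) (Finset.sum_nonneg hnn)
  have h3 := (Finset.sum_eq_zero_iff_of_nonneg hnn).1 h2
  have h4 : φ v0 - φ w = 0 := by
    rw [← map_sub, hsum, map_sum]
    apply Finset.sum_eq_zero
    intro u hu
    rw [map_smul, smul_eq_mul]
    rcases mul_eq_zero.1 (h3 u hu) with h | h
    · rw [h, zero_mul]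
    · have hlt : χ (w + u) + k < R := by
        rw [map_add, h, add_zero]; exact hlow w hwV
      rw [(hG w hwV u (hs u hu) hlt).1, mul_zero]
  exact hwne (by linarith)

open scoped NNReal in
lemma cn_inherit {Λ : AddSubgroup E} {P : Set E} (hP : Convex ℝ P) {G : Set E} {V' : Finset E}
    {χ φ : E →L[ℝ] ℝ} {k R l l' b : ℝ} (hll : l' ≤ l) {v w : E} (hvb : φ v = b)
    (hGP : ∀ e ∈ G, v + e ∈ P)
    (hG : ∀ e ∈ G, χ (v + e) + k < R →
      φ e = 0 ∧ v + e ∈ V' ∧ ∃ y ∈ Λ, φ y = 0 ∧ ∃ t : ℝ, l ≤ t ∧ e = t • y)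
    (hw : φ w = b) (hcone : w - v ∈ Submodule.span ℝ≥0 G) :
    w - v ∈ Submodule.span ℝ≥0 (cnGood (cnKer Λ φ) (P ∩ {x | φ x = b}) V' χ k R l' v) := by
  refine cn_slice _ φ ?_ ?_ hcone (by rw [map_sub, hw, hvb, sub_self])
  · intro e he he0
    apply Submodule.subset_span
    refine ⟨⟨hGP e he, by simp [he0, hvb]⟩, ?_⟩
    rcases le_or_gt R (χ (v + e) + k) with h | h
    · exact Or.inl h
    · obtain ⟨-, h2, y, hy, hy0, t, ht, hty⟩ := hG e he h
      exact Or.inr ⟨h2, y, ⟨hy, hy0⟩, t, hll.trans ht, hty⟩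
  · intro e he f hf hep hfn
    have he1 : R ≤ χ (v + e) + k := by
      by_contra h; push Not at h
      exact hep.ne' (hG e he h).1
    have hf1 : R ≤ χ (v + f) + k := by
      by_contra h; push Not at h
      exact hfn.ne (hG f hf h).1
    have hs : 0 < φ e - φ f := by linarith
    set a := (-φ f) / (φ e - φ f) with ha
    set c := φ e / (φ e - φ f) with hc
    have hac : a + c = 1 := by rw [ha, hc]; field_simp; ring
    have ha0 : 0 ≤ a := div_nonneg (by linarith) hs.le
    have hc0 : 0 ≤ c := div_nonneg hep.le hs.le
    have hac' : a * φ e + c * φ f = 0 := by rw [ha, hc]; field_simp; ring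
    have hv : v + (a • e + c • f) = a • (v + e) + c • (v + f) := by
      have : v = (a + c) • v := by rw [hac, one_smul]
      conv_lhs => rw [this]
      module
    have hm : a • e + c • f ∈ cnGood (cnKer Λ φ) (P ∩ {x | φ x = b}) V' χ k R l' v := by
      refine ⟨⟨?_, ?_⟩, Or.inl ?_⟩
      · rw [hv]; exact hP (hGP e he) (hGP f hf) ha0 hc0 hac
      · simp [hvb, hac']
      · rw [hv, map_add, map_smul, map_smul, smul_eq_mul, smul_eq_mul]
        have : a = 1 - c := by linarith
        rw [this] at ha0 ⊢
        nlinarith [mul_le_mul_of_nonneg_left he1 ha0, mul_le_mul_of_nonneg_left hf1 hc0]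
    have := cn_cone_smul _ hs.le (Submodule.subset_span hm :
      _ ∈ Submodule.span ℝ≥0 (cnGood (cnKer Λ φ) (P ∩ {x | φ x = b}) V' χ k R l' v))
    convert this using 1
    rw [smul_add, smul_smul, smul_smul, ha, hc, mul_div_cancel₀ _ hs.ne', mul_div_cancel₀ _ hs.ne']

open scoped NNReal in
/-- The conclusion/hypothesis package for the main induction. -/
def CnProp (E : Type*) [NormedAddCommGroup E] [NormedSpace ℝ E] (n : ℕ) (μ K R l : ℝ) : Prop :=
  ∀ Λ : AddSubgroup E, CnSep Λ →
    Module.finrank ℝ (Submodule.span ℝ (Λ : Set E)) ≤ n →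
    ∀ P : Set E, IsCompact P → Convex ℝ P →
    (∀ p ∈ P, ∀ p' ∈ P, p - p' ∈ Submodule.span ℝ (Λ : Set E)) →
    ∀ V : Finset E, (V : Set E) ⊆ P → ∀ (χ : E →L[ℝ] ℝ) (k : ℝ),
    (∀ p ∈ P, 0 ≤ χ p + k) → (∀ v ∈ V, χ v + k < R) →
    (∀ v ∈ V, ∀ w ∈ V, w - v ∈ Submodule.span ℝ≥0 (cnGood Λ P V χ k R l v)) →
    ∀ α β : ℝ, μ ≤ α → α ≤ K → μ ≤ β → β ≤ K →
    ∀ q ∈ convexHull ℝ (V : Set E), χ q + k ≤ 1 →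
    ∃ v ∈ V, ∃ x ∈ P, ∃ p ∈ P, α • x - α • v ∈ Λ ∧ (α + β) • q = α • x + β • p

/-- Flatness dichotomy at the point `q`. -/
lemma cn_dich [FiniteDimensional ℝ E] {n : ℕ} {μ α β : ℝ} (hμ : 0 < μ) (hα : μ ≤ α) (hβ : μ ≤ β)
    {Λ : AddSubgroup E} (hS : CnSep Λ)
    (hn : Module.finrank ℝ (Submodule.span ℝ (Λ : Set E)) ≤ n)
    {P : Set E} (hPc : IsCompact P) (hP : Convex ℝ P)
    (hPL : ∀ p ∈ P, ∀ p' ∈ P, p - p' ∈ Submodule.span ℝ (Λ : Set E))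
    {q v : E} (hq : q ∈ P) (hv : v ∈ P) :
    (∃ x ∈ P, ∃ p ∈ P, α • x - α • v ∈ Λ ∧ (α + β) • q = α • x + β • p) ∨
    ∃ φ : E →L[ℝ] ℝ, CnIntOn Λ φ ∧ (∃ x ∈ Λ, φ x ≠ 0) ∧ ∃ g : E →L[ℝ] ℝ,
      ∀ p ∈ P, ∀ p' ∈ P, φ p - φ p' + g (p - q) + g (p' - q) < 2 * ((16 : ℝ) ^ n / μ) := by
  set M : Set E := {z | q + μ⁻¹ • z ∈ P ∧ q - μ⁻¹ • z ∈ P} with hM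
  have hα0 : 0 < α := hμ.trans_le hα
  have hβ0 : 0 < β := hμ.trans_le hβ
  by_cases H : ∀ φ, CnIntOn Λ φ → (∃ x ∈ Λ, φ x ≠ 0) → ∃ m ∈ M, (16 : ℝ) ^ n ≤ φ m
  · left
    have hMc : IsCompact M := by
      have h1 : IsCompact ((fun x => μ • (x - q)) '' P) :=
        hPc.image (by fun_prop)
      refine h1.of_isClosed_subset ?_ ?_
      · exact (hPc.isClosed.preimage (f := fun z => q + μ⁻¹ • z) (by fun_prop)).inter
          (hPc.isClosed.preimage (f := fun z => q - μ⁻¹ • z) (by fun_prop))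
      · rintro z ⟨hz, -⟩
        refine ⟨_, hz, ?_⟩
        simp only [add_sub_cancel_left]
        rw [smul_smul, mul_inv_cancel₀ hμ.ne', one_smul]
    have hMx : Convex ℝ M := by
      intro z hz z' hz' a b ha hb hab
      have hqq : q = a • q + b • q := by rw [← add_smul, hab, one_smul]
      constructor
      · have := hP hz.1 hz'.1 ha hb hab
        convert this using 1
        conv_lhs => rw [hqq]
        module
      · have := hP hz.2 hz'.2 ha hb hab
        convert this using 1
        conv_lhs => rw [hqq]
        module
    have h0 : (0 : E) ∈ M := by simp [hM, hq]
    have hMs : ∀ m ∈ M, -m ∈ M := by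
      rintro m ⟨h1, h2⟩
      refine ⟨?_, ?_⟩
      · rw [smul_neg, ← sub_eq_add_neg]; exact h2
      · rw [smul_neg, sub_neg_eq_add]; exact h1
    have hMW : M ⊆ Submodule.span ℝ (Λ : Set E) := by
      rintro m ⟨h1, h2⟩
      have := hPL _ h1 _ hq
      rw [add_sub_cancel_left] at this
      exact (Submodule.smul_mem_iff _ (inv_ne_zero hμ.ne')).1 this
    obtain ⟨z, hz, hzΛ⟩ := cn_flat n Λ hS hn M hMc hMx hMs h0 hMW H (α • (v - q))
      (Submodule.smul_mem _ _ (hPL _ hv _ hq))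
    have hseg1 : ∀ γ : ℝ, μ ≤ γ → q + γ⁻¹ • z ∈ P := by
      intro γ hγ
      have hγ0 : 0 < γ := hμ.trans_le hγ
      have hr : μ / γ ≤ 1 := (div_le_one hγ0).2 hγ
      have := hP hq hz.1 (sub_nonneg.2 hr) (div_nonneg hμ.le hγ0.le) (by ring)
      convert this using 1
      have e : γ⁻¹ = μ / γ * μ⁻¹ := by field_simp
      rw [e]; module
    have hseg2 : ∀ γ : ℝ, μ ≤ γ → q - γ⁻¹ • z ∈ P := by
      intro γ hγ
      have hγ0 : 0 < γ := hμ.trans_le hγ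
      have hr : μ / γ ≤ 1 := (div_le_one hγ0).2 hγ
      have := hP hq hz.2 (sub_nonneg.2 hr) (div_nonneg hμ.le hγ0.le) (by ring)
      convert this using 1
      have e : γ⁻¹ = μ / γ * μ⁻¹ := by field_simp
      rw [e]; module
    refine ⟨_, hseg1 α hα, _, hseg2 β hβ, ?_, ?_⟩
    · convert hzΛ using 1
      rw [smul_add, smul_smul, mul_inv_cancel₀ hα0.ne']; module
    · rw [smul_add, smul_sub, smul_smul, smul_smul, mul_inv_cancel₀ hα0.ne',
        mul_inv_cancel₀ hβ0.ne']; module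
  · right
    push Not at H
    obtain ⟨φ, hφ, hx, hlt⟩ := H
    refine ⟨φ, hφ, hx, ?_⟩
    set Y : Set E := (fun p => p - q) '' P with hY
    have hYc : IsCompact Y := hPc.image (by fun_prop)
    have hYx : Convex ℝ Y := by
      have := hP.translate (-q)
      convert this using 1
      ext z; simp [hY, sub_eq_add_neg, add_comm]
    have hY0 : (0 : E) ∈ Y := ⟨q, hq, by simp⟩
    obtain ⟨g, hg⟩ := cn_sepLin (E := E) (Y ×ˢ Y) (hYx.prod hYx) (hYc.prod hYc) ⟨hY0, hY0⟩
      (ContinuousLinearMap.fst ℝ E E + ContinuousLinearMap.snd ℝ E E)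
      (φ.comp (ContinuousLinearMap.fst ℝ E E) - φ.comp (ContinuousLinearMap.snd ℝ E E))
      (2 * ((16 : ℝ) ^ n / μ)) (by
        rintro ⟨y, y'⟩ ⟨⟨p, hp, hpy⟩, ⟨p', hp', hpy'⟩⟩ h0
        simp at h0 hpy hpy' ⊢
        have hyy : y' = -y := by rw [eq_neg_iff_add_eq_zero, add_comm]; exact h0
        have hmem : μ • y ∈ M := by
          constructor
          · rw [smul_smul, inv_mul_cancel₀ hμ.ne', one_smul, ← hpy]; simpa using hp
          · rw [smul_smul, inv_mul_cancel₀ hμ.ne', one_smul]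
            have : q - y = p' := by rw [sub_eq_add_neg, ← hyy, ← hpy']; abel
            rw [this]; exact hp'
        have h1 := hlt _ hmem
        rw [map_smul, smul_eq_mul] at h1
        have h2 : φ y < (16 : ℝ) ^ n / μ := by rw [lt_div_iff₀ hμ]; linarith
        rw [hyy, map_neg]; linarith)
    refine ⟨g, fun p hp p' hp' => ?_⟩
    have := hg (p - q, p' - q) ⟨⟨p, hp, rfl⟩, ⟨p', hp', rfl⟩⟩
    simp at this ⊢
    linarith

open scoped NNReal in
lemma cn_step [FiniteDimensional ℝ E] {n : ℕ} {μ K R0 R' l' : ℝ} (hμ : 0 < μ) (hR1 : 1 ≤ R')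
    (hR2 : 2 * K / μ ≤ R') (hl' : 0 < l') (ih : CnProp E n (μ / 2) K R' l') :
    ∃ R l : ℝ, R0 ≤ R ∧ 0 < l ∧ CnProp E (n + 1) μ K R l := by
  classical
  set C : ℝ := (16 : ℝ) ^ (n + 1) / μ with hC
  have hC0 : 0 < C := by positivity
  set D : ℝ := 2 * (1 + C) with hD
  have hD0 : 0 < D := by positivity
  refine ⟨max (D * R') R0, max (2 * (D * R')) l', le_max_right _ _,
    lt_of_lt_of_le hl' (le_max_right _ _), ?_⟩
  set R := max (D * R') R0 with hR
  set l := max (2 * (D * R')) l' with hl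
  have hRD : D * R' ≤ R := le_max_left _ _
  have hlD : 2 * (D * R') ≤ l := le_max_left _ _
  have hl0 : 0 < l := lt_of_lt_of_le hl' (le_max_right _ _)
  intro Λ hS hn P hPc hP hPL V hVP χ k hpos hlow hcone α β hα hαK hβ hβK q hq hq1
  have hα0 : 0 < α := hμ.trans_le hα
  have hβ0 : 0 < β := hμ.trans_le hβ
  have hVne : V.Nonempty := by
    have := convexHull_nonempty_iff.1 ⟨q, hq⟩
    exact_mod_cast this
  have hVhP : convexHull ℝ (V : Set E) ⊆ P := convexHull_min hVP hP
  have hqP := hVhP hq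
  obtain ⟨v1, hv1⟩ := hVne
  rcases cn_dich hμ hα hβ hS hn hPc hP hPL hqP (hVP hv1) with h | h
  · obtain ⟨x, hx, p, hp, h⟩ := h
    exact ⟨v1, hv1, x, hx, p, hp, h⟩
  obtain ⟨φ, hφ, ⟨l0, hl0Λ, hl0'⟩, g, hg⟩ := h
  set χ' : E →L[ℝ] ℝ := D⁻¹ • (χ - g) with hχ'
  set k' : ℝ := D⁻¹ * (k + C + g q) with hk'
  have hψ : ∀ p, D * (χ' p + k') = (χ p + k) + (C - g (p - q)) := by
    intro p
    have : χ' p = D⁻¹ * (χ p - g p) := by simp [hχ']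
    rw [this, hk', map_sub]
    field_simp
    ring
  have hψ2 : ∀ p ∈ P, 0 ≤ C - g (p - q) := by
    intro p hp
    have := hg p hp p hp
    rw [← hC] at this
    linarith
  have hφψ : ∀ p ∈ P, ∀ p' ∈ P, φ p - φ p' < (C - g (p - q)) + (C - g (p' - q)) := by
    intro p hp p' hp'
    have := hg p hp p' hp'
    rw [← hC] at this
    linarith
  have hpos' : ∀ p ∈ P, 0 ≤ χ' p + k' := by
    intro p hp
    have h1 := hψ p
    have h2 := hψ2 p hp
    have h3 := hpos p hp
    by_contra hcon; push Not at hcon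
    nlinarith
  have hq' : χ' q + k' ≤ 1 / 2 := by
    have h1 := hψ q
    rw [sub_self, map_zero, sub_zero] at h1
    by_contra hcon; push Not at hcon
    nlinarith
  have hG : ∀ v ∈ P, χ' v + k' < R' → ∀ e ∈ cnGood Λ P V χ k R l v, χ' (v + e) + k' < R' →
      φ e = 0 ∧ v + e ∈ V.filter (fun v => χ' v + k' < R') ∧
        ∃ y ∈ Λ, φ y = 0 ∧ ∃ t : ℝ, l ≤ t ∧ e = t • y := by
    rintro v hv hvl e ⟨heP, he⟩ hel
    have e1 := hψ (v + e)
    have e2 := mul_lt_mul_of_pos_left hel hD0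
    have e3 := hψ2 _ heP
    rcases he with he | ⟨heV, y, hy, t, ht, hty⟩
    · linarith
    · have hy0 : φ y = 0 := by
        by_contra hne
        obtain ⟨m, hm⟩ := hφ y hy
        have hm1 : (1 : ℝ) ≤ |φ y| := by
          rw [hm] at hne ⊢
          have : m ≠ 0 := by rintro rfl; simp at hne
          exact_mod_cast Int.one_le_abs this
        have hφe : φ e = t * φ y := by rw [hty]; simp
        have ht0 : 0 < t := hl0.trans_le ht
        have habs : l ≤ |φ e| := by
          rw [hφe, abs_mul, abs_of_pos ht0]; nlinarith
        have f1 := hψ v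
        have f2 := mul_lt_mul_of_pos_left hvl hD0
        have f3 := hpos v hv
        have f4 := hpos _ heP
        have g1 := hφψ _ heP _ hv
        have g2 := hφψ _ hv _ heP
        rw [map_add φ] at g1 g2
        rcases le_abs.1 habs with h | h <;> linarith
      refine ⟨by rw [hty]; simp [hy0], Finset.mem_filter.2 ⟨heV, hel⟩, y, hy, hy0, t, ht, hty⟩
  obtain ⟨t, f, g', ht0, htR, hf, hg', hqd, hf1⟩ :=
    cn_decomp hR1 (fun v hv => hpos' v (hVP hv)) hq hq'
  set V' := V.filter (fun v => χ' v + k' < R') with hV'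
  have hV'V : ∀ v ∈ V', v ∈ V := fun v hv => (Finset.mem_filter.1 hv).1
  have hV'low : ∀ v ∈ V', χ' v + k' < R' := fun v hv => (Finset.mem_filter.1 hv).2
  have hV'ne : V'.Nonempty := by
    have := convexHull_nonempty_iff.1 ⟨f, hf⟩
    exact_mod_cast this
  obtain ⟨v0, hv0, hv0min⟩ := Finset.exists_min_image V' (fun v => χ' v) hV'ne
  have hconst : ∀ w ∈ V', φ w = φ v0 :=
    cn_conn (G := cnGood Λ P V χ k R l) (χ := χ') (k := k') (R := R') hV'low
      (fun v hv e he hel =>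
        have := hG v (hVP (hV'V v hv)) (hV'low v hv) e he hel
        ⟨this.1, this.2.1⟩)
      (fun v hv w hw => hcone v (hV'V v hv) w (hV'V w hw)) hv0 hv0min
  set b := φ v0 with hb
  have hPb : IsClosed {x : E | φ x = b} := isClosed_eq φ.continuous continuous_const
  have hPbx : Convex ℝ {x : E | φ x = b} := by
    intro x hx y hy a c ha hc hac
    simp only [mem_setOf_eq] at hx hy ⊢
    rw [map_add, map_smul, map_smul, hx, hy, smul_eq_mul, smul_eq_mul, ← add_mul, hac, one_mul]
  have htK : (α + β) * t ≤ μ / 2 := by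
    have h2 : 2 * K ≤ R' * μ := by rwa [div_le_iff₀ hμ] at hR2
    have h1 : (α + β) * t ≤ 2 * K * t := mul_le_mul_of_nonneg_right (by linarith) ht0
    nlinarith
  have ht1 : 0 ≤ (α + β) * t := by positivity
  obtain ⟨v, hv, x, hx, p', hp', hxΛ, heq⟩ := ih (cnKer Λ φ) (cnSep_ker hS φ)
    (cn_finrank_ker hl0Λ hl0' hn) (P ∩ {x | φ x = b}) (hPc.inter_right hPb) (hP.inter hPbx)
    (fun p hp p' hp' => cn_span_ker hφ hl0Λ hl0' (hPL p hp.1 p' hp'.1)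
      (by rw [map_sub, hp.2, hp'.2, sub_self]))
    V' (fun v hv => ⟨hVP (hV'V v hv), hconst v hv⟩) χ' k' (fun p hp => hpos' p hp.1) hV'low
    (fun v hv w hw => cn_inherit (l := l) hP (le_max_right _ _) (hconst v hv)
      (fun e he => he.1) (hG v (hVP (hV'V v hv)) (hV'low v hv)) (hconst w hw)
      (hcone v (hV'V v hv) w (hV'V w hw)))
    α (β - (α + β) * t) (by linarith) hαK (by linarith) (by linarith) f hf hf1
  refine ⟨v, hV'V v hv, x, hx.1, ((β - (α + β) * t) / β) • p' + (((α + β) * t) / β) • g', ?_,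
    hxΛ.1, ?_⟩
  · exact hP hp'.1 (hVhP hg') (div_nonneg (by linarith) hβ0.le) (div_nonneg ht1 hβ0.le)
      (by field_simp; ring)
  · rw [smul_add, smul_smul, smul_smul, mul_div_cancel₀ _ hβ0.ne', mul_div_cancel₀ _ hβ0.ne',
      ← add_assoc, ← heq]
    conv_lhs => rw [hqd]
    module

theorem cn_main [FiniteDimensional ℝ E] (n : ℕ) : ∀ μ K R0 : ℝ, 0 < μ →
    ∃ R l : ℝ, R0 ≤ R ∧ 0 < l ∧ CnProp E n μ K R l := by
  induction n with
  | zero =>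
    intro μ K R0 hμ
    refine ⟨R0, 1, le_rfl, one_pos, ?_⟩
    intro Λ hS hn P hPc hP hPL V hVP χ k hpos hlow hcone α β hα hαK hβ hβK q hq hq1
    have hb : Submodule.span ℝ (Λ : Set E) = ⊥ := Submodule.finrank_eq_zero.1 (by omega)
    have hVne : V.Nonempty := by
      have := convexHull_nonempty_iff.1 ⟨q, hq⟩
      exact_mod_cast this
    have hqP := convexHull_min hVP hP hq
    obtain ⟨v, hv⟩ := hVne
    have : q = v := by
      have := hPL q hqP v (hVP hv)
      rw [hb, Submodule.mem_bot] at this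
      exact sub_eq_zero.1 this
    subst this
    exact ⟨q, hv, q, hqP, q, hqP, by simp [Λ.zero_mem], by rw [add_smul]⟩
  | succ n ih =>
    intro μ K R0 hμ
    obtain ⟨R', l', h1, h2, h3⟩ := ih (μ / 2) K (max 1 (2 * K / μ)) (half_pos hμ)
    exact cn_step hμ ((le_max_left _ _).trans h1) ((le_max_right _ _).trans h1) h2 h3

lemma cn_pointed {V : Finset E} {v : E} (hv : v ∈ extremePoints ℝ (convexHull ℝ (V : Set E)))
    {S : Finset E} (hS : S ⊆ V) (hvS : v ∉ S) {c : E → ℝ} (hc : ∀ s ∈ S, 0 ≤ c s)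
    (h : ∑ s ∈ S, c s • (s - v) = 0) : ∀ s ∈ S, c s = 0 := by
  classical
  by_contra hcon
  push Not at hcon
  obtain ⟨u, hu, hune⟩ := hcon
  have hT : 0 < ∑ s ∈ S, c s :=
    Finset.sum_pos' hc ⟨u, hu, lt_of_le_of_ne (hc u hu) (Ne.symm hune)⟩
  set T := ∑ s ∈ S, c s with hTdef
  have hsum : ∑ s ∈ S, c s • s = T • v := by
    simp only [smul_sub, Finset.sum_sub_distrib, ← Finset.sum_smul] at h
    exact sub_eq_zero.1 h
  have hvS' : v ∈ convexHull ℝ (S : Set E) := by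
    refine Finset.mem_convexHull'.2 ⟨fun s => T⁻¹ * c s, fun s hs =>
      mul_nonneg (inv_nonneg.2 hT.le) (hc s hs), ?_, ?_⟩
    · rw [← Finset.mul_sum, ← hTdef, inv_mul_cancel₀ hT.ne']
    · have : ∑ s ∈ S, (T⁻¹ * c s) • s = T⁻¹ • ∑ s ∈ S, c s • s := by
        rw [Finset.smul_sum]; exact Finset.sum_congr rfl (fun s _ => by rw [smul_smul])
      rw [this, hsum, smul_smul, inv_mul_cancel₀ hT.ne', one_smul]
  have h1 : v ∈ extremePoints ℝ (convexHull ℝ (S : Set E)) :=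
    inter_extremePoints_subset_extremePoints_of_subset
      (convexHull_mono (by exact_mod_cast hS)) ⟨hvS', hv⟩
  exact hvS (by exact_mod_cast extremePoints_convexHull_subset h1)

open scoped NNReal in
lemma cn_edges {V : Finset E}
    (hV : ∀ v ∈ V, v ∈ extremePoints ℝ (convexHull ℝ (V : Set E))) {v : E} (hv : v ∈ V)
    {w : E} (hw : w ∈ V) :
    w - v ∈ Submodule.span ℝ≥0 {e : E | v + e ∈ V ∧ v ≠ v + e ∧
      IsExtreme ℝ (convexHull ℝ (V : Set E)) (segment ℝ v (v + e))} := by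
  classical
  set P := convexHull ℝ (V : Set E) with hPdef
  have hVP : ∀ u ∈ V, u ∈ P := fun u hu => subset_convexHull ℝ _ (by exact_mod_cast hu)
  let Rep : Finset E → E → Prop := fun S x =>
    ∃ a : E → ℝ, (∀ s, 0 ≤ a s) ∧ x = ∑ s ∈ S, a s • (s - v)
  have hfull : V.erase v ∈ (V.erase v).powerset.filter (fun S => ∀ w ∈ V, Rep S (w - v)) := by
    refine Finset.mem_filter.2 ⟨Finset.mem_powerset_self _, fun w hw => ?_⟩
    by_cases hwv : w = v
    · exact ⟨fun _ => 0, fun _ => le_rfl, by simp [hwv]⟩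
    · refine ⟨fun s => if s = w then 1 else 0, fun s => by dsimp only; split_ifs <;> norm_num, ?_⟩
      have : w ∈ V.erase v := Finset.mem_erase.2 ⟨hwv, hw⟩
      simp only [ite_smul, one_smul, zero_smul]
      rw [Finset.sum_ite_eq' (V.erase v) w (fun s => s - v), if_pos this]
  obtain ⟨S, hSm, hSmin⟩ := Finset.exists_min_image _ (fun S : Finset E => S.card) ⟨_, hfull⟩
  obtain ⟨hSp, hSr⟩ := Finset.mem_filter.1 hSm
  have hSV : S ⊆ V.erase v := Finset.mem_powerset.1 hSp
  have hSV' : S ⊆ V := hSV.trans (Finset.erase_subset _ _)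
  have hvS : v ∉ S := fun h => (Finset.mem_erase.1 (hSV h)).1 rfl
  have hPr : ∀ p ∈ P, Rep S (p - v) := by
    intro p hp
    obtain ⟨c, hc0, hc1, hcp⟩ := Finset.mem_convexHull'.1 hp
    choose! a ha0 ha using hSr
    refine ⟨fun s => ∑ u ∈ V, c u * a u s, fun s => Finset.sum_nonneg (fun u hu =>
      mul_nonneg (hc0 u hu) (ha0 u hu s)), ?_⟩
    have h1 : p - v = ∑ u ∈ V, c u • (u - v) := by
      simp only [smul_sub, Finset.sum_sub_distrib, ← Finset.sum_smul, hc1, one_smul, hcp]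
    rw [h1]
    simp only [Finset.sum_smul]
    rw [Finset.sum_comm]
    refine Finset.sum_congr rfl (fun u hu => ?_)
    conv_lhs => rw [ha u hu]
    rw [Finset.smul_sum]
    exact Finset.sum_congr rfl (fun s _ => by rw [smul_smul])
  have hedge : ∀ u ∈ S, IsExtreme ℝ P (segment ℝ v u) := by
    intro u hu
    have huV := hSV' hu
    have huv : u ≠ v := fun h => hvS (h ▸ hu)
    refine ⟨(convex_convexHull ℝ _).segment_subset (hVP v hv) (hVP u huV), ?_⟩
    intro x hx y hy z hz hzo
    obtain ⟨τ, hτ, rfl⟩ := (segment_eq_image' ℝ v u ▸ hz : z ∈ _ '' _)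
    obtain ⟨a, b, ha, hb, hab, hzab⟩ := hzo
    obtain ⟨ξ, hξ0, hξ⟩ := hPr x hx
    obtain ⟨η, hη0, hη⟩ := hPr y hy
    set c : E → ℝ := fun s => a * ξ s + b * η s with hc
    have hc0 : ∀ s, 0 ≤ c s := fun s =>
      add_nonneg (mul_nonneg ha.le (hξ0 s)) (mul_nonneg hb.le (hη0 s))
    have key : τ • (u - v) = ∑ s ∈ S, c s • (s - v) := by
      have h1 : τ • (u - v) = a • (x - v) + b • (y - v) := by
        have : v = (a + b) • v := by rw [hab, one_smul]
        have h2 : τ • (u - v) = a • x + b • y - v := by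
          rw [hzab]; simp
        rw [h2]
        conv_lhs => rw [this]
        module
      rw [h1, hξ, hη, Finset.smul_sum, Finset.smul_sum, ← Finset.sum_add_distrib]
      exact Finset.sum_congr rfl (fun s _ => by rw [hc]; module)
    have key2 : (τ - c u) • (u - v) = ∑ s ∈ S.erase u, c s • (s - v) := by
      rw [← Finset.add_sum_erase S _ hu] at key
      rw [sub_smul, key]; abel
    have hκ : τ - c u ≤ 0 := by
      by_contra hκ
      push Not at hκ
      set κ := τ - c u with hκd
      have hmem : S.erase u ∈ (V.erase v).powerset.filter (fun S => ∀ w ∈ V, Rep S (w - v)) := by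
        refine Finset.mem_filter.2 ⟨Finset.mem_powerset.2 ((Finset.erase_subset _ _).trans hSV),
          fun w hw => ?_⟩
        obtain ⟨a', ha'0, ha'⟩ := hSr w hw
        refine ⟨fun s => a' s + a' u * κ⁻¹ * c s, fun s => add_nonneg (ha'0 s)
          (mul_nonneg (mul_nonneg (ha'0 u) (inv_nonneg.2 hκ.le)) (hc0 s)), ?_⟩
        rw [ha', ← Finset.add_sum_erase S _ hu]
        have h1 : u - v = κ⁻¹ • ∑ s ∈ S.erase u, c s • (s - v) := by
          rw [← key2, smul_smul, inv_mul_cancel₀ hκ.ne', one_smul]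
        simp only [add_smul, Finset.sum_add_distrib]
        rw [add_comm]
        congr 1
        conv_lhs => rw [h1]
        rw [smul_smul, Finset.smul_sum]
        exact Finset.sum_congr rfl (fun s _ => by rw [smul_smul])
      have := hSmin _ hmem
      have h2 := Finset.card_erase_lt_of_mem hu
      omega
    have hz0 := cn_pointed (hV v hv) hSV' hvS (c := fun s => if s = u then -(τ - c u) else c s)
      (fun s _ => by
        by_cases h : s = u
        · simp only [h, if_true]; linarith
        · simp only [h, if_false]; exact hc0 s)
      (by
        rw [← Finset.add_sum_erase S _ hu]
        have : ∑ s ∈ S.erase u, (if s = u then -(τ - c u) else c s) • (s - v)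
            = ∑ s ∈ S.erase u, c s • (s - v) :=
          Finset.sum_congr rfl (fun s hs => by rw [if_neg (Finset.mem_erase.1 hs).1])
        rw [this, ← key2, if_pos rfl]
        module)
    have hξs : ∀ s ∈ S.erase u, ξ s = 0 := by
      intro s hs
      obtain ⟨h1, h2⟩ := Finset.mem_erase.1 hs
      have h3 := hz0 s h2
      simp only [h1, if_false, hc] at h3
      have h4 := mul_nonneg hb.le (hη0 s)
      have h5 := mul_nonneg ha.le (hξ0 s)
      have h6 : a * ξ s = 0 := by linarith
      exact (mul_eq_zero.1 h6).resolve_left ha.ne'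
    have hxu : x - v = ξ u • (u - v) := by
      rw [hξ, ← Finset.add_sum_erase S _ hu, Finset.sum_eq_zero (s := S.erase u), add_zero]
      intro s hs
      rw [hξs s hs, zero_smul]
    have hξ1 : ξ u ≤ 1 := by
      by_contra hcon
      push Not at hcon
      have hpos : 0 < ξ u := by linarith
      have huo : u ∈ openSegment ℝ v x := by
        refine ⟨1 - (ξ u)⁻¹, (ξ u)⁻¹, sub_pos.2 (inv_lt_one_of_one_lt₀ hcon), inv_pos.2 hpos,
          by ring, ?_⟩
        have : (ξ u)⁻¹ • (x - v) = u - v := by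
          rw [hxu, smul_smul, inv_mul_cancel₀ hpos.ne', one_smul]
        have h2 : (1 - (ξ u)⁻¹) • v + (ξ u)⁻¹ • x = v + (ξ u)⁻¹ • (x - v) := by module
        rw [h2, this]; abel
      exact huv (((hV u huV).2 (hVP v hv) hx huo)).symm
    rw [segment_eq_image']
    exact ⟨ξ u, ⟨hξ0 u, hξ1⟩, by simp only [← hxu]; abel⟩
  obtain ⟨a, ha0, ha⟩ := hSr w hw
  rw [ha]
  refine Submodule.sum_mem _ (fun s hs => cn_cone_smul _ (ha0 s) (Submodule.subset_span ?_))
  have e : v + (s - v) = s := by abel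
  simp only [mem_setOf_eq, e]
  exact ⟨hSV' hs, fun h => hvS (h ▸ hs), hedge s hs⟩

end helpers

def cnZ (d : ℕ) : AddSubgroup (Pt d) where
  carrier := {x | IsLatticePt x}
  add_mem' := by
    intro a b ha hb i
    obtain ⟨m, hm⟩ := ha i
    obtain ⟨n, hn⟩ := hb i
    exact ⟨m + n, by simp [hm, hn]⟩
  zero_mem' := fun i => ⟨0, by simp⟩
  neg_mem' := by
    intro a ha i
    obtain ⟨m, hm⟩ := ha i
    exact ⟨-m, by simp [hm]⟩

lemma cnZ_sep (d : ℕ) : CnSep (cnZ d) := by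
  intro x _ hx0
  have : ∃ i, x i ≠ 0 := by
    by_contra h
    push Not at h
    exact hx0 (by ext i; simpa using h i)
  obtain ⟨i, hi⟩ := this
  exact ⟨EuclideanSpace.proj i, fun y hy => by simpa using hy i, by simpa using hi⟩

lemma cnZ_span (d : ℕ) (x : Pt d) : x ∈ Submodule.span ℝ (cnZ d : Set (Pt d)) := by
  classical
  have h : x = ∑ i, x i • (EuclideanSpace.single i (1 : ℝ) : Pt d) := by
    ext j
    simp [Pi.single_apply]
  rw [h]
  refine Submodule.sum_mem _ (fun i _ => Submodule.smul_mem _ _ (Submodule.subset_span ?_))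
  intro j
  refine ⟨if j = i then 1 else 0, ?_⟩
  simp [Pi.single_apply]

lemma cn_primvec {d : ℕ} {e : Pt d} (he : IsRatPt e) (he0 : e ≠ 0) :
    ∃ (u : Fin d → ℤ) (t : ℝ), 0 < t ∧ IsPrimitive u ∧ ∀ i, e i = t * (u i : ℝ) := by
  classical
  choose q hq using he
  obtain ⟨b, hb⟩ := IsLocalization.exist_integer_multiples_of_finite (nonZeroDivisors ℤ) q
  have hb0 : (b : ℤ) ≠ 0 := nonZeroDivisors.ne_zero b.2
  choose m hm using hb
  have hm' : ∀ i, ((b : ℤ) : ℝ) * e i = (m i : ℝ) := by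
    intro i
    have := hm i
    rw [hq i]
    simp at this
    exact_mod_cast this.symm
  obtain ⟨i0, hi0⟩ : ∃ i, e i ≠ 0 := by
    by_contra h
    push Not at h
    exact he0 (by ext i; simpa using h i)
  obtain ⟨u, hu, hu1⟩ := Finset.extract_gcd (s := Finset.univ) (fun i => (b : ℤ) * m i)
    ⟨i0, Finset.mem_univ _⟩
  set g := Finset.univ.gcd (fun i => (b : ℤ) * m i) with hg
  have hbR : ((b : ℤ) : ℝ) ≠ 0 := by exact_mod_cast hb0
  have hg0 : g ≠ 0 := by
    intro h0
    have := hu i0 (Finset.mem_univ _)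
    rw [h0, zero_mul] at this
    rcases mul_eq_zero.1 this with h | h
    · exact hb0 h
    · have h1 := hm' i0
      rw [h, Int.cast_zero] at h1
      exact hi0 ((mul_eq_zero.1 h1).resolve_left hbR)
  have hgn : 0 ≤ g := Int.nonneg_of_normalize_eq_self Finset.normalize_gcd
  have hgp : (0 : ℝ) < g := by exact_mod_cast lt_of_le_of_ne hgn (Ne.symm hg0)
  have hbb : (0 : ℝ) < ((b : ℤ) : ℝ) * ((b : ℤ) : ℝ) := mul_self_pos.2 hbR
  refine ⟨u, g / (((b : ℤ) : ℝ) * ((b : ℤ) : ℝ)), div_pos hgp hbb, hu1, fun i => ?_⟩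
  have h1 : (((b : ℤ) * m i : ℤ) : ℝ) = ((g * u i : ℤ) : ℝ) := by
    exact_mod_cast hu i (Finset.mem_univ _)
  push_cast at h1
  rw [← hm' i] at h1
  rw [div_mul_eq_mul_div, eq_div_iff hbb.ne', ← h1]
  ring


/-- Corollary 5.2(b). For every `d ≥ 1` and `k ≥ 2` there is a rational bound
`l` such that every rational `d`-polytope with edges of lattice length `≥ l` is
`k`-convex-normal. -/
theorem statement15 (d : ℕ) (hd : 0 < d) (k : ℚ) (hk : 2 ≤ k) :
    ∃ l : ℚ, ∀ P : Set (Pt d), IsRationalPolytope P → polyDim P = d →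
      EdgeLengthsGE P (l : ℝ) → ConvexNormal k P := by
  classical
  obtain ⟨R, l, hR, hl, H⟩ := cn_main (E := Pt d) d 1 (k : ℝ) 1 one_pos
  obtain ⟨lq, hlq⟩ := exists_rat_gt l
  refine ⟨lq, ?_⟩
  rintro P ⟨V0, hV0, hPV0⟩ - hE
  have hPc : IsCompact P := by rw [hPV0]; exact V0.finite_toSet.isCompact_convexHull ℝ
  have hPx : Convex ℝ P := by rw [hPV0]; exact convex_convexHull ℝ _
  have hsub : extremePoints ℝ P ⊆ (V0 : Set (Pt d)) := by
    rw [hPV0]; exact extremePoints_convexHull_subset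
  have hfin : (extremePoints ℝ P).Finite := V0.finite_toSet.subset hsub
  set V := hfin.toFinset with hV
  have hVc : (V : Set (Pt d)) = extremePoints ℝ P := hfin.coe_toFinset
  have hVm : ∀ v, v ∈ V ↔ v ∈ extremePoints ℝ P := fun v => hfin.mem_toFinset
  have hPV : P = convexHull ℝ (V : Set (Pt d)) := by
    have h1 := closure_convexHull_extremePoints hPc hPx
    have h2 : IsClosed (convexHull ℝ (extremePoints ℝ P)) :=
      (hfin.isCompact_convexHull ℝ).isClosed
    rw [h2.closure_eq] at h1
    rw [hVc]
    exact h1.symm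
  have hrat : ∀ v ∈ V, IsRatPt v := fun v hv => hV0 v (by exact_mod_cast hsub ((hVm v).1 hv))
  intro c hc2 hck
  have hc2' : (2 : ℝ) ≤ c := by exact_mod_cast hc2
  have hck' : (c : ℝ) ≤ k := by exact_mod_cast hck
  have hk' : (2 : ℝ) ≤ k := by exact_mod_cast hk
  apply Subset.antisymm
  · rintro y ⟨q, hq, rfl⟩
    obtain ⟨v, hv, x, hx, p, hp, hxv, heq⟩ := H (cnZ d) (cnZ_sep d)
      ((Submodule.finrank_le _).trans (by simp)) P hPc hPx (fun _ _ _ _ => cnZ_span d _) V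
      (by rw [hVc]; exact extremePoints_subset) 0 0 (by simp) (fun v _ => by simp; linarith)
      (fun v hv w hw => by
        refine Submodule.span_mono ?_ (cn_edges (V := V)
          (fun v hv => by rw [← hPV]; exact (hVm v).1 hv) hv hw)
        rintro e ⟨he1, he2, he3⟩
        rw [← hPV] at he3
        have heP : v + e ∈ P := extremePoints_subset ((hVm _).1 he1)
        refine ⟨heP, Or.inr ⟨he1, ?_⟩⟩
        have her : IsRatPt e := by
          intro i
          obtain ⟨a, ha⟩ := hrat _ he1 i
          obtain ⟨b, hb⟩ := hrat _ hv i
          refine ⟨a - b, ?_⟩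
          push_cast
          rw [← ha, ← hb]; simp
        have he0 : e ≠ 0 := fun h => he2 (by rw [h, add_zero])
        obtain ⟨u, t, ht, hu, hut⟩ := cn_primvec her he0
        have hlt := hE v (v + e) ⟨he2, he3⟩ u t ht hu (fun i => by rw [← hut i]; simp)
        refine ⟨WithLp.toLp 2 (fun i => (u i : ℝ)), fun i => ⟨u i, rfl⟩, t,
          hlq.le.trans hlt, ?_⟩
        ext i
        simp [hut i])
      ((c : ℝ) - 1) 1 (by linarith) (by linarith) le_rfl (by linarith) q (by rwa [← hPV])
      (by simp)
    refine ⟨v, (hVm v).1 hv, ((c : ℝ) - 1) • x, smul_mem_smul_set hx, hxv, p, hp, ?_⟩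
    rw [one_smul, sub_add_cancel] at heq
    exact heq
  · rintro y ⟨v, -, x, hx, -, p, hp, rfl⟩
    have h1 := hPx.add_smul (p := (c : ℝ) - 1) (q := 1) (by linarith) zero_le_one
    rw [sub_add_cancel, one_smul] at h1
    rw [h1]
    exact add_mem_add hx hp
end
end
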